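/- arXiv:1406.2999 — 2 statements merged into one kernel-verified Lean document; each statement's English description precedes it below -/
import Mathlib

section
/- Let p ≥ 5 be a prime, let k be a positive integer, and let F ∈ ℤ_(p)[Q,R] be isobaric of weight k and not involving P. Then the p-th derivative D^pF is a modular form mod p; precisely, there exists a polynomial G ∈ ℤ_(p)[Q,R], isobaric of weight k+2p and not involving P, such that D^pF − G ∈ p·ℤ_(p)[P,Q,R]. -/
open MvPolynomial Finset

noncomputable section

/-- `x` lies in `ℤ_(p) ⊆ ℚ`: `p` does not divide the reduced denominator of `x`. -/
def pInt (p : ℕ) (x : ℚ) : Prop := ¬ p ∣ x.den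

/-- The polynomial ring `ℚ[P,Q,R]`, with `P = X 0`, `Q = X 1`, `R = X 2`. -/
abbrev Poly3 : Type := MvPolynomial (Fin 3) ℚ

/-- `f` has all of its coefficients in `ℤ_(p)`. -/
def polyPInt (p : ℕ) (f : Poly3) : Prop := ∀ m : Fin 3 →₀ ℕ, pInt p (coeff m f)

/-- `f` is isobaric of weight `w`, where `P, Q, R` have weights `2, 4, 6`. -/
def Isobaric (w : ℕ) (f : Poly3) : Prop :=
  ∀ m ∈ f.support, 2 * m 0 + 4 * m 1 + 6 * m 2 = w

/-- `f` does not involve the variable `P`. -/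
def NoP (f : Poly3) : Prop := ∀ m ∈ f.support, m 0 = 0

/-- The Ramanujan derivation `D` on `ℚ[P,Q,R]`, the unique derivation with
`DP = (P²-Q)/12`, `DQ = (PQ-R)/3`, `DR = (PR-Q²)/2`. -/
def Dop (f : Poly3) : Poly3 :=
  C (1/12 : ℚ) * (X 0 ^ 2 - X 1) * pderiv 0 f
    + C (1/3 : ℚ) * (X 0 * X 1 - X 2) * pderiv 1 f
    + C (1/2 : ℚ) * (X 0 * X 2 - X 1 ^ 2) * pderiv 2 f

/-- The sum of the `j`-th powers of the divisors of `n`, as a rational number. -/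
def sigmaQ (j n : ℕ) : ℚ := ∑ d ∈ n.divisors, (d : ℚ) ^ j

/-- The q-expansion of `E₂`. -/
def E2s : PowerSeries ℚ := PowerSeries.mk fun n => if n = 0 then 1 else -24 * sigmaQ 1 n

/-- The q-expansion of `E₄`. -/
def E4s : PowerSeries ℚ := PowerSeries.mk fun n => if n = 0 then 1 else 240 * sigmaQ 3 n

/-- The q-expansion of `E₆`. -/
def E6s : PowerSeries ℚ := PowerSeries.mk fun n => if n = 0 then 1 else -504 * sigmaQ 5 n

/-- The q-expansion of the normalized Eisenstein series `E_{p-1}`. -/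
def EAs (p : ℕ) : PowerSeries ℚ :=
  PowerSeries.mk fun n => if n = 0 then 1 else
    -(2 * ((p : ℚ) - 1) / bernoulli (p - 1)) * sigmaQ (p - 2) n

/-- The q-expansion of the normalized Eisenstein series `E_{p+1}`. -/
def EBs (p : ℕ) : PowerSeries ℚ :=
  PowerSeries.mk fun n => if n = 0 then 1 else
    -(2 * ((p : ℚ) + 1) / bernoulli (p + 1)) * sigmaQ p n

/-- `Φ : ℚ[P,Q,R] → ℚ[[q]]`, the algebra map sending `P, Q, R` to `E₂, E₄, E₆`. -/
def Phi : Poly3 →ₐ[ℚ] PowerSeries ℚ := aeval ![E2s, E4s, E6s]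

/-- The theta operator attached to the polynomials `A` and `B`:
`θf = ((BQ-AR)/3)·∂f/∂Q + ((BR-AQ²)/2)·∂f/∂R`. -/
def thetaOp (A B f : Poly3) : Poly3 :=
  C (1/3 : ℚ) * (B * X 1 - A * X 2) * pderiv 1 f
    + C (1/2 : ℚ) * (B * X 2 - A * X 1 ^ 2) * pderiv 2 f

/-- `f` lies in the `n`-th power of the ideal `(A^p, p)` of `ℤ_(p)[P,Q,R]`. -/
def InIdealPow (p : ℕ) (A : Poly3) (n : ℕ) (f : Poly3) : Prop :=
  ∃ G : ℕ → Poly3, (∀ i, polyPInt p (G i)) ∧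
    f = ∑ i ∈ Finset.range (n + 1), (p : Poly3) ^ (n - i) * A ^ (p * i) * G i


theorem pInt_add {p : ℕ} (hp : p.Prime) {x y : ℚ} (hx : pInt p x) (hy : pInt p y) :
    pInt p (x + y) := fun h =>
  (hp.dvd_mul.1 (h.trans (Rat.add_den_dvd x y))).elim hx hy

theorem pInt_mul {p : ℕ} (hp : p.Prime) {x y : ℚ} (hx : pInt p x) (hy : pInt p y) :
    pInt p (x * y) := fun h =>
  (hp.dvd_mul.1 (h.trans (Rat.mul_den_dvd x y))).elim hx hy

theorem pInt_natCast {p : ℕ} (hp : p.Prime) (n : ℕ) : pInt p (n : ℚ) := by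
  simp [pInt, hp.one_lt.ne']

theorem pInt_inv_natCast {p : ℕ} {n : ℕ} (h : ¬ p ∣ n) : pInt p ((n : ℚ)⁻¹) := by
  have hn : n ≠ 0 := by rintro rfl; simp at h
  intro h'
  apply h
  have := Rat.den_dvd 1 n
  rw [Rat.divInt_eq_div] at this
  simp only [Int.cast_one, Int.cast_natCast, one_div] at this
  exact h'.trans (Int.natCast_dvd_natCast.1 this)

theorem polyPInt_add {p : ℕ} (hp : p.Prime) {f g : Poly3} (hf : polyPInt p f)
    (hg : polyPInt p g) : polyPInt p (f + g) := fun m => by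
  rw [coeff_add]; exact pInt_add hp (hf m) (hg m)

theorem polyPInt_neg {p : ℕ} {f : Poly3} (hf : polyPInt p f) : polyPInt p (-f) := fun m => by
  rw [coeff_neg]; simpa [pInt] using hf m

theorem polyPInt_sub {p : ℕ} (hp : p.Prime) {f g : Poly3} (hf : polyPInt p f)
    (hg : polyPInt p g) : polyPInt p (f - g) := by
  rw [sub_eq_add_neg]; exact polyPInt_add hp hf (polyPInt_neg hg)

theorem polyPInt_mul {p : ℕ} (hp : p.Prime) {f g : Poly3} (hf : polyPInt p f)
    (hg : polyPInt p g) : polyPInt p (f * g) := fun m => by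
  rw [coeff_mul]
  refine Finset.sum_induction _ (pInt p) (fun _ _ => pInt_add hp) ?_ ?_
  · simpa using pInt_natCast hp 0
  · intro x _; exact pInt_mul hp (hf _) (hg _)

theorem polyPInt_C {p : ℕ} (hp : p.Prime) {x : ℚ} (hx : pInt p x) :
    polyPInt p (C x : Poly3) := fun m => by
  rw [coeff_C]; split_ifs
  · exact hx
  · simpa using pInt_natCast hp 0

theorem polyPInt_X {p : ℕ} (hp : p.Prime) (i : Fin 3) : polyPInt p (X i : Poly3) := fun m => by
  rw [coeff_X]; split_ifs
  · simpa using pInt_natCast hp 1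
  · simpa using pInt_natCast hp 0

theorem polyPInt_pderiv {p : ℕ} (hp : p.Prime) (i : Fin 3) {f : Poly3} (hf : polyPInt p f) :
    polyPInt p (pderiv i f) := fun m => by
  rw [coeff_pderiv]
  refine pInt_mul hp (hf _) ?_
  exact_mod_cast pInt_natCast hp (m i + 1)

theorem not_dvd_twelve {p : ℕ} (hp : p.Prime) (hp5 : 5 ≤ p) : ¬ p ∣ 12 := by
  intro h
  rw [show 12 = 2 * 2 * 3 by norm_num, hp.dvd_mul, hp.dvd_mul] at h
  rcases h with (h | h) | h <;> have := Nat.le_of_dvd (by norm_num) h <;> omega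

theorem polyPInt_Dop {p : ℕ} (hp : p.Prime) (hp5 : 5 ≤ p) {f : Poly3} (hf : polyPInt p f) :
    polyPInt p (Dop f) := by
  have h12 := not_dvd_twelve hp hp5
  have a1 : pInt p (1 / 12) := by
    simpa using pInt_inv_natCast h12
  have a2 : pInt p (1 / 3) := by
    simpa using pInt_inv_natCast (n := 3) (fun h => h12 (h.trans (by norm_num)))
  have a3 : pInt p (1 / 2) := by
    simpa using pInt_inv_natCast (n := 2) (fun h => h12 (h.trans (by norm_num)))
  have hX := fun i => polyPInt_X hp i
  unfold Dop
  simp only [pow_two]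
  refine polyPInt_add hp (polyPInt_add hp ?_ ?_) ?_ <;>
    refine polyPInt_mul hp (polyPInt_mul hp (polyPInt_C hp (by assumption)) ?_)
      (polyPInt_pderiv hp _ hf)
  · exact polyPInt_sub hp (polyPInt_mul hp (hX 0) (hX 0)) (hX 1)
  · exact polyPInt_sub hp (polyPInt_mul hp (hX 0) (hX 1)) (hX 2)
  · exact polyPInt_sub hp (polyPInt_mul hp (hX 0) (hX 2)) (polyPInt_mul hp (hX 1) (hX 1))

theorem isobaric_iff_nat (w : ℕ) (f : Poly3) :
    Isobaric w f ↔ IsWeightedHomogeneous (![2, 4, 6] : Fin 3 → ℕ) f w := by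
  unfold Isobaric IsWeightedHomogeneous
  simp only [mem_support_iff, Finsupp.weight_apply]
  refine forall_congr' fun m => ?_
  rw [Finsupp.sum_fintype _ _ (by simp)]
  simp [Fin.sum_univ_three, mul_comm]

theorem isobaric_iff_int (w : ℕ) (f : Poly3) :
    Isobaric w f ↔ IsWeightedHomogeneous (![2, 4, 6] : Fin 3 → ℤ) f (w : ℤ) := by
  unfold Isobaric IsWeightedHomogeneous
  simp only [mem_support_iff, Finsupp.weight_apply]
  refine forall_congr' fun m => ?_
  rw [Finsupp.sum_fintype _ _ (by simp)]
  simp [Fin.sum_univ_three, mul_comm]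
  refine imp_congr_right fun _ => ?_
  norm_cast

theorem isobaric_Dop {w : ℕ} {f : Poly3} (hf : Isobaric w f) : Isobaric (w + 2) (Dop f) := by
  rw [isobaric_iff_int] at hf ⊢
  have hd : ∀ i, IsWeightedHomogeneous (![2, 4, 6] : Fin 3 → ℤ) (pderiv i f)
      ((w : ℤ) - (![2, 4, 6] : Fin 3 → ℤ) i) := fun i => hf.pderiv (by ring)
  have hX := fun i => isWeightedHomogeneous_X ℚ (![2, 4, 6] : Fin 3 → ℤ) i
  have key : ∀ (i : Fin 3) (c : ℚ) (g : Poly3) (a : ℤ), a = (![2, 4, 6] : Fin 3 → ℤ) i + 2 →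
      IsWeightedHomogeneous (![2, 4, 6] : Fin 3 → ℤ) g a →
      IsWeightedHomogeneous (![2, 4, 6] : Fin 3 → ℤ) (C c * g * pderiv i f)
        ((w + 2 : ℕ) : ℤ) := by
    intro i c g a ha hg
    have := (hg.C_mul c).mul (hd i)
    rwa [show a + ((w : ℤ) - (![2, 4, 6] : Fin 3 → ℤ) i) = ((w + 2 : ℕ) : ℤ) by
      push_cast; rw [ha]; ring] at this
  unfold Dop
  refine ((key 0 _ _ 4 (by simp) ?_).add (key 1 _ _ 6 (by simp) ?_)).add (key 2 _ _ 8 (by simp) ?_)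
  · exact IsWeightedHomogeneous.sub (by simpa using (hX 0).pow 2) (by simpa using hX 1)
  · exact IsWeightedHomogeneous.sub (by simpa using (hX 0).mul (hX 1)) (by simpa using hX 2)
  · exact IsWeightedHomogeneous.sub (by simpa using (hX 0).mul (hX 2))
      (by simpa using (hX 1).pow 2)

theorem pderiv_comm3 (i j : Fin 3) (f : Poly3) :
    pderiv i (pderiv j f) = pderiv j (pderiv i f) := by
  have h : ⁅(pderiv i : Derivation ℚ Poly3 Poly3), (pderiv j : Derivation ℚ Poly3 Poly3)⁆ = 0 := by
    apply derivation_ext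
    intro l
    rw [Derivation.commutator_apply, pderiv_X, pderiv_X]
    simp only [Pi.single_apply]
    split_ifs <;> simp
  have := congrArg (fun d : Derivation ℚ Poly3 Poly3 => d f) h
  simpa [Derivation.commutator_apply, sub_eq_zero] using this

theorem Dop_natCast_mul (n : ℕ) (f : Poly3) : Dop ((n : Poly3) * f) = (n : Poly3) * Dop f := by
  unfold Dop
  simp only [pderiv_mul, Derivation.map_natCast]
  ring

theorem comm_pderiv_Dop (f : Poly3) :
    12 * pderiv 0 (Dop f) = Dop (12 * pderiv 0 f)
      + (2 * (X 0 * pderiv 0 f) + 4 * (X 1 * pderiv 1 f) + 6 * (X 2 * pderiv 2 f)) := by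
  have h12 : (C (1/12) : Poly3) * 12 = 1 := by
    rw [show (12 : Poly3) = C 12 from (map_ofNat C 12).symm, ← C_mul]; norm_num
  have h3 : (C (1/3) : Poly3) = C (1/12) * 4 := by
    rw [show (4 : Poly3) = C 4 from (map_ofNat C 4).symm, ← C_mul]; norm_num
  have h2 : (C (1/2) : Poly3) = C (1/12) * 6 := by
    rw [show (6 : Poly3) = C 6 from (map_ofNat C 6).symm, ← C_mul]; norm_num
  rw [show (12 : Poly3) * pderiv 0 f = ((12 : ℕ) : Poly3) * pderiv 0 f by simp, Dop_natCast_mul]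
  unfold Dop
  simp only [map_add, map_sub, pderiv_mul, pderiv_C, pderiv_pow, pderiv_X_self,
    pderiv_X_of_ne (show (1 : Fin 3) ≠ 0 by decide), pderiv_X_of_ne (show (2 : Fin 3) ≠ 0 by decide),
    pderiv_comm3 1 0, pderiv_comm3 2 0]
  simp only [h3, h2]
  push_cast
  linear_combination (2 * (X 0 * pderiv 0 f) + 4 * (X 1 * pderiv 1 f) + 6 * (X 2 * pderiv 2 f)) * h12

theorem isobaric_iter {k : ℕ} {F : Poly3} (hF : Isobaric k F) (n : ℕ) :
    Isobaric (k + 2 * n) (Dop^[n] F) := by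
  induction n with
  | zero => simpa using hF
  | succ n ih =>
    rw [Function.iterate_succ_apply']
    exact isobaric_Dop ih

theorem polyPInt_iter {p : ℕ} (hp : p.Prime) (hp5 : 5 ≤ p) {F : Poly3} (hF : polyPInt p F)
    (n : ℕ) : polyPInt p (Dop^[n] F) := by
  induction n with
  | zero => simpa using hF
  | succ n ih =>
    rw [Function.iterate_succ_apply']
    exact polyPInt_Dop hp hp5 ih

theorem euler3 {w : ℕ} {f : Poly3} (hf : Isobaric w f) :
    2 * (X 0 * pderiv 0 f) + 4 * (X 1 * pderiv 1 f) + 6 * (X 2 * pderiv 2 f) = (w : Poly3) * f := by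
  have := ((isobaric_iff_nat w f).1 hf).sum_weight_X_mul_pderiv
  simpa [Fin.sum_univ_three] using this

theorem pderiv_zero_of_NoP {F : Poly3} (hF : NoP F) : pderiv 0 F = 0 := by
  ext m
  rw [coeff_pderiv, coeff_zero]
  by_cases h : coeff (m + Finsupp.single 0 1) F = 0
  · simp [h]
  · have := hF _ (mem_support_iff.2 h)
    simp at this

theorem pderiv_iter {k : ℕ} {F : Poly3} (hF : Isobaric k F) (hP : NoP F) (n : ℕ) :
    12 * pderiv 0 (Dop^[n + 1] F) = (((n + 1) * (k + n) : ℕ) : Poly3) * Dop^[n] F := by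
  induction n with
  | zero =>
    simp only [zero_add, Function.iterate_one, Function.iterate_zero, id]
    rw [comm_pderiv_Dop, euler3 hF, pderiv_zero_of_NoP hP]
    simp [Dop]
  | succ n ih =>
    rw [Function.iterate_succ_apply', comm_pderiv_Dop, ih, euler3 (isobaric_iter hF (n + 1)),
      Dop_natCast_mul, ← Function.iterate_succ_apply' Dop n F]
    push_cast
    ring

theorem coeff_iter {p : ℕ} (hp : p.Prime) (hp5 : 5 ≤ p) {k : ℕ} {F : Poly3}
    (hF : Isobaric (k + 1) F) (hP : NoP F) (hI : polyPInt p F) (n : ℕ) :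
    ∀ (j : ℕ) (m : Fin 3 →₀ ℕ), m 0 = j → ∃ c, pInt p c ∧ coeff m (Dop^[n] F) * 12 ^ j
      = (n.choose j : ℚ) * ((k + n).descFactorial j : ℚ) * c := by
  induction n with
  | zero =>
    intro j m hm
    rcases j with _ | j
    · exact ⟨coeff m F, hI m, by simp⟩
    · refine ⟨0, by simpa using pInt_natCast hp 0, ?_⟩
      have : coeff m F = 0 := by
        by_contra h
        have := hP m (mem_support_iff.2 h)
        omega
      simp [this]
  | succ n ih =>
    intro j m hm
    rcases j with _ | j
    · exact ⟨coeff m (Dop^[n + 1] F), polyPInt_iter hp hp5 hI _ m, by simp⟩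
    · obtain ⟨m', rfl⟩ : ∃ m', m = m' + Finsupp.single 0 1 :=
        ⟨m - Finsupp.single 0 1, (tsub_add_cancel_of_le (by simp [hm])).symm⟩
      have hm' : m' 0 = j := by simpa using hm
      obtain ⟨c, hc, h⟩ := ih j m' hm'
      refine ⟨c, hc, ?_⟩
      have h1 := congrArg (coeff m') (pderiv_iter hF hP n)
      rw [show (12 : Poly3) = C 12 from (map_ofNat C 12).symm, coeff_C_mul, coeff_pderiv, hm',
        show ((((n + 1) * (k + 1 + n) : ℕ) : Poly3)) = C ((((n + 1) * (k + 1 + n) : ℕ) : ℚ)) by simp,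
        coeff_C_mul] at h1
      have h2 : ((n + 1 : ℕ) : ℚ) * (n.choose j : ℚ)
          = ((n + 1).choose (j + 1) : ℚ) * ((j + 1 : ℕ) : ℚ) := by
        exact_mod_cast Nat.add_one_mul_choose_eq n j
      rw [show k + (n + 1) = k + n + 1 by ring, Nat.succ_descFactorial_succ]
      have hj : ((j : ℚ) + 1) ≠ 0 := by positivity
      apply mul_right_cancel₀ hj
      push_cast at h1 h2 ⊢
      rw [pow_succ]
      linear_combination 12 ^ j * h1 + ((n : ℚ) + 1) * (k + 1 + n) * h
        + (k + n + 1 : ℚ) * ((k + n).descFactorial j : ℚ) * c * h2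

theorem dvd_aux {p : ℕ} (hp : p.Prime) (a j : ℕ) (hj : j ≠ 0) :
    p ∣ p.choose j * a.descFactorial j := by
  rcases lt_trichotomy j p with h | h | h
  · exact (hp.dvd_choose_self hj h).mul_right _
  · subst h
    rw [Nat.descFactorial_eq_factorial_mul_choose]
    exact ((Nat.dvd_factorial hp.pos le_rfl).mul_right _).mul_left _
  · simp [Nat.choose_eq_zero_of_lt h]

theorem stmt_5 (p : ℕ) (hp : p.Prime) (hp5 : 5 ≤ p)
    (k : ℕ) (hk : 0 < k) (F : Poly3) (hFiso : Isobaric k F) (hFnoP : NoP F)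
    (hFint : polyPInt p F) :
    ∃ G H : Poly3, Isobaric (k + 2 * p) G ∧ NoP G ∧ polyPInt p G ∧
      polyPInt p H ∧ Dop^[p] F - G = (p : Poly3) * H := by
  classical
  obtain ⟨k, rfl⟩ : ∃ k', k = k' + 1 := ⟨k - 1, by omega⟩
  set E := Dop^[p] F with hE
  have hEi : Isobaric (k + 1 + 2 * p) E := isobaric_iter hFiso p
  have hEp : polyPInt p E := polyPInt_iter hp hp5 hFint p
  have hp0 : (p : ℚ) ≠ 0 := by exact_mod_cast hp.ne_zero
  let G : Poly3 := ∑ m ∈ E.support with m 0 = 0, monomial m (coeff m E)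
  have hG : ∀ m, coeff m G = if m 0 = 0 then coeff m E else 0 := by
    intro m
    simp only [G, coeff_sum, coeff_monomial]
    rw [Finset.sum_ite_eq' _ m (fun m => coeff m E)]
    by_cases h0 : m 0 = 0 <;> by_cases hm : coeff m E = 0 <;> simp [h0, hm]
  refine ⟨G, C ((p : ℚ)⁻¹) * (E - G), ?_, ?_, ?_, ?_, ?_⟩
  · intro m hm
    rw [mem_support_iff, hG] at hm
    exact hEi m (mem_support_iff.2 fun h => hm (by simp [h]))
  · intro m hm
    rw [mem_support_iff, hG] at hm
    by_contra h
    simp [h] at hm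
  · intro m
    rw [hG]
    split_ifs
    · exact hEp m
    · simpa using pInt_natCast hp 0
  · intro m
    rw [coeff_C_mul, coeff_sub, hG]
    split_ifs with h
    · simpa using pInt_natCast hp 0
    · obtain ⟨c, hc, hcm⟩ := coeff_iter hp hp5 hFiso hFnoP hFint p (m 0) m rfl
      obtain ⟨d, hd⟩ := dvd_aux hp (k + p) (m 0) h
      have hd' : (p.choose (m 0) : ℚ) * ((k + p).descFactorial (m 0) : ℚ) = p * d := by
        exact_mod_cast hd
      have : (p : ℚ)⁻¹ * (coeff m E - 0) = d * c * (((12 ^ m 0 : ℕ) : ℚ))⁻¹ := by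
        rw [hd'] at hcm
        push_cast
        field_simp
        linear_combination hcm
      rw [this]
      refine pInt_mul hp (pInt_mul hp (pInt_natCast hp d) hc) (pInt_inv_natCast ?_)
      exact fun h => not_dvd_twelve hp hp5 (hp.dvd_of_dvd_pow h)
  · rw [← mul_assoc, show (p : Poly3) = C (p : ℚ) by simp, ← C_mul, mul_inv_cancel₀ hp0]
    simp
end
end

section
/- Let p ≥ 5 be a prime, let k be a positive integer, and let F ∈ ℤ_(p)[Q,R] be isobaric of weight k and not involving P. Then for every positive integer r, D^{rp}F ≡ A^r·θ^rF (mod p); that is, D^{rp}F − A^r·θ^rF ∈ p·ℤ_(p)[P,Q,R]. -/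
open MvPolynomial Finset

noncomputable section

/-- The operator `q d/dq` on power series. -/
def qd {R : Type} [CommRing R] (f : PowerSeries R) : PowerSeries R :=
  PowerSeries.mk fun n => (n : R) * PowerSeries.coeff n f

/-- The integral power series `1 + c ∑ σ_j(n) q^n`. -/
def eisZ (c : ℤ) (j : ℕ) : PowerSeries ℤ :=
  PowerSeries.mk fun n => if n = 0 then 1 else c * ∑ d ∈ n.divisors, (d : ℤ) ^ j

section Analytic

open UpperHalfPlane Function ModularForm EisensteinSeries Derivative MatrixGroups
open scoped Manifold

/-- `f` is a holomorphic 1-periodic function bounded at infinity with q-expansion `a`. -/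
structure GoodQ (f : ℍ → ℂ) (a : PowerSeries ℂ) : Prop where
  per : Periodic (f ∘ ofComplex) (1 : ℝ)
  hol : MDiff f
  bdd : IsBoundedAtImInfty f
  hq : qExpansion 1 f = a

lemma GoodQ.ana {f a} (h : GoodQ f a) : AnalyticAt ℂ (cuspFunction 1 f) 0 :=
  analyticAt_cuspFunction_zero one_pos h.per h.hol h.bdd

lemma GoodQ.hasSum {f a} (h : GoodQ f a) (τ : ℍ) :
    HasSum (fun m : ℕ ↦ a.coeff m • Periodic.qParam 1 τ ^ m) (f τ) := by
  rw [← h.hq]; exact hasSum_qExpansion one_pos h.per h.hol h.bdd τ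

lemma GoodQ.mul {f g a b} (hf : GoodQ f a) (hg : GoodQ g b) : GoodQ (f * g) (a * b) where
  per := by
    intro z
    have h1 := hf.per z
    have h2 := hg.per z
    simp only [comp_apply, Pi.mul_apply] at *
    rw [h1, h2]
  hol := hf.hol.mul hg.hol
  bdd := hf.bdd.mul hg.bdd
  hq := by rw [qExpansion_mul hf.ana hg.ana, hf.hq, hg.hq]

lemma GoodQ.sub {f g a b} (hf : GoodQ f a) (hg : GoodQ g b) : GoodQ (f - g) (a - b) where
  per := by
    intro z
    have h1 := hf.per z
    have h2 := hg.per z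
    simp only [comp_apply, Pi.sub_apply] at *
    rw [h1, h2]
  hol := hf.hol.sub hg.hol
  bdd := by
    have := hf.bdd.add hg.bdd.neg_left
    rw [sub_eq_add_neg]; exact this
  hq := by rw [qExpansion_sub hf.ana hg.ana, hf.hq, hg.hq]

lemma GoodQ.smul {f a} (c : ℂ) (hf : GoodQ f a) : GoodQ (c • f) (c • a) where
  per := by
    intro z
    have h1 := hf.per z
    simp only [comp_apply, Pi.smul_apply] at *
    rw [h1]
  hol := hf.hol.const_smul c
  bdd := hf.bdd.const_smul_left c
  hq := by rw [qExpansion_smul hf.ana, hf.hq]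

lemma GoodQ.of_hasSum {f : ℍ → ℂ} {a : PowerSeries ℂ} (hol : MDiff f)
    (h : ∀ τ : ℍ, HasSum (fun m : ℕ ↦ a.coeff m • Periodic.qParam 1 τ ^ m) (f τ)) : GoodQ f a := by
  have per : Periodic (f ∘ ofComplex) (1 : ℝ) := by
    intro z
    by_cases hz : 0 < z.im
    · have hz' : 0 < (z + (1 : ℝ)).im := by simpa using hz
      simp only [comp_apply, ofComplex_apply_of_im_pos hz, ofComplex_apply_of_im_pos hz']
      refine (h _).unique ?_
      convert! h ⟨z, hz⟩ using 3
      simp only [Periodic.qParam]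
      rw [show (2 * Real.pi * Complex.I * ((⟨z + (1 : ℝ), hz'⟩ : ℍ) : ℂ) / ((1 : ℝ) : ℂ)) =
        2 * Real.pi * Complex.I * ((⟨z, hz⟩ : ℍ) : ℂ) / ((1 : ℝ) : ℂ) + 2 * Real.pi * Complex.I by
          simp; ring]
      rw [Complex.exp_periodic]
    · have hz' : (z + (1 : ℝ)).im ≤ 0 := by simpa using hz
      push Not at hz
      simp only [comp_apply, ofComplex_apply_of_im_nonpos hz, ofComplex_apply_of_im_nonpos hz']
  have bdd := isBoundedAtImInfty_of_hasSum_qExpansion one_pos h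
  refine ⟨per, hol, bdd, ?_⟩
  let _ : FunLike (ℍ → ℂ) ℍ ℂ := ⟨id, fun _ _ h => h⟩
  ext m
  exact (qExpansion_coeff_unique f one_pos (analyticAt_cuspFunction_zero one_pos per hol bdd) h m).symm

lemma GoodQ.nderiv {f a} (hf : GoodQ f a) :
    GoodQ (normalizedDerivOfComplex f) (qd a) := by
  refine GoodQ.of_hasSum (normalizedDerivOfComplex_mdifferentiable hf.hol) fun τ => ?_
  have hd := differentiableOn_cuspFunction_ball one_pos hf.per hf.hol hf.bdd
  have hq1 : ‖Periodic.qParam 1 (τ : ℂ)‖ < 1 := Periodic.norm_qParam_lt_one one_pos τ.im_pos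
  have hmem : Periodic.qParam 1 (τ : ℂ) ∈ Metric.ball (0 : ℂ) 1 := by simpa using hq1
  have hs := Complex.hasSum_taylorSeries_on_ball (hd.deriv Metric.isOpen_ball) hmem
  have hval : normalizedDerivOfComplex f τ =
      Periodic.qParam 1 (τ : ℂ) * deriv (cuspFunction 1 f) (Periodic.qParam 1 (τ : ℂ)) := by
    have h1 : HasDerivAt (Periodic.qParam 1) (2 * Real.pi * Complex.I * Periodic.qParam 1 (τ : ℂ))
        (τ : ℂ) := by
      have : HasDerivAt (fun z : ℂ => Complex.exp (2 * Real.pi * Complex.I * z / (1 : ℝ)))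
          (Complex.exp (2 * Real.pi * Complex.I * τ / (1 : ℝ)) *
            (2 * Real.pi * Complex.I * 1 / (1 : ℝ))) (τ : ℂ) :=
        (((hasDerivAt_id (τ : ℂ)).const_mul _).div_const _).cexp
      convert! this using 1
      simp [Periodic.qParam, mul_comm]
    have h2 : HasDerivAt (cuspFunction 1 f) (deriv (cuspFunction 1 f) (Periodic.qParam 1 (τ : ℂ)))
        (Periodic.qParam 1 (τ : ℂ)) :=
      (hd.differentiableAt (Metric.isOpen_ball.mem_nhds hmem)).hasDerivAt
    have h3 := h2.comp (τ : ℂ) h1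
    have h4 : f ∘ ofComplex = cuspFunction 1 f ∘ Periodic.qParam 1 := by
      ext z
      simpa [cuspFunction] using
        (Periodic.eq_cuspFunction one_ne_zero hf.per z).symm
    rw [normalizedDerivOfComplex, h4, h3.deriv]
    have : (2 * Real.pi * Complex.I : ℂ) ≠ 0 := by simp [Real.pi_ne_zero]
    field_simp
  rw [← hasSum_nat_add_iff' 1]
  simp only [qd, Finset.sum_range_one, PowerSeries.coeff_mk, Nat.cast_zero, zero_mul, zero_smul, sub_zero]
  rw [hval]
  convert! hs.mul_left (Periodic.qParam 1 (τ : ℂ)) using 2 with n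
  rw [← hf.hq, qExpansion_coeff, ← iteratedDeriv_succ', Nat.factorial_succ]
  have : (n.factorial : ℂ) ≠ 0 := by exact_mod_cast n.factorial_ne_zero
  have : (n + 1 : ℂ) ≠ 0 := by exact_mod_cast n.succ_ne_zero
  push_cast
  simp only [smul_eq_mul, sub_zero]
  field_simp
  ring

lemma GoodQ.eq_zero {f a} (hf : GoodQ f a) (k : ℕ) (hk : k < 12)
    (hs : ∀ γ : SL(2, ℤ), f ∣[(k : ℤ)] γ = f) (h0 : a.coeff 0 = 0) : a = 0 := by
  let F : ModularForm 𝒮ℒ (k : ℤ) :=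
    { toFun := f
      slash_action_eq' := by
        rintro γ ⟨g, rfl⟩
        exact hs g
      holo' := hf.hol
      bdd_at_cusps' := by
        intro c hc
        rw [Subgroup.IsArithmetic.isCusp_iff_isCusp_SL2Z] at hc
        rw [OnePoint.isBoundedAt_iff_forall_SL2Z hc]
        intro γ hγ
        rw [hs]
        exact hf.bdd }
  have hF : (F : ℍ → ℂ) = f := rfl
  have := ModularForm.sturm_bound_levelOne_nat (f := F) (by
    rw [hF, hf.hq, Nat.div_eq_of_lt hk]
    rw [Nat.cast_zero, pos_iff_ne_zero, ne_eq, ← ne_eq,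
      PowerSeries.order_ne_zero_iff_constCoeff_eq_zero]
    simpa using h0)
  rw [← hf.hq, ← hF, this]
  exact qExpansion_zero 1

lemma D2_hasDeriv (γ : SL(2, ℤ)) (z : ℍ) :
    HasDerivAt (D2 γ ∘ ofComplex)
      (2 * Real.pi * Complex.I * γ 1 0 * (-(γ 1 0) / (denom γ z) ^ 2)) (z : ℂ) := by
  have h := hasDerivAt_denom_zpow (γ : GL (Fin 2) ℝ) (-1) z
  have h2 := h.const_mul (2 * Real.pi * Complex.I * γ 1 0)
  have he : D2 γ ∘ ofComplex =ᶠ[nhds (z : ℂ)]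
      fun w => 2 * Real.pi * Complex.I * γ 1 0 * denom (γ : GL (Fin 2) ℝ) w ^ (-1 : ℤ) := by
    filter_upwards [isOpen_upperHalfPlaneSet.mem_nhds z.im_pos] with w hw
    simp [D2, ofComplex_apply_of_im_pos hw, div_eq_mul_inv]
  convert! h2.congr_of_eventuallyEq he using 1
  simp [div_eq_mul_inv, zpow_neg]
  try norm_cast

lemma E2_slash_aux (γ : SL(2, ℤ)) :
    (normalizedDerivOfComplex E2 - (12 : ℂ)⁻¹ • (E2 * E2)) ∣[(4 : ℤ)] γ =
      normalizedDerivOfComplex E2 - (12 : ℂ)⁻¹ • (E2 * E2) := by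
  have hD := normalizedDerivOfComplex_SL_slash (k := 2) E2_mdifferentiable (γ := γ)
  have hE := E2_slash_action γ
  have hm := ModularForm.mul_slash_SL2 2 2 γ E2 E2
  norm_num at hm
  ext z
  have hd := D2_hasDeriv γ z
  have hE2 : HasDerivAt (E2 ∘ ofComplex) _ (z : ℂ) :=
    (mdifferentiableAt_iff.mp (E2_mdifferentiable z)).hasDerivAt
  have hsub : HasDerivAt ((E2 - (1 / (2 * riemannZeta 2)) • D2 γ) ∘ ofComplex) _ (z : ℂ) :=
    hE2.sub (hd.const_smul (1 / (2 * riemannZeta 2)))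
  have hDz := congrFun hD z
  have hmz := congrFun hm z
  have hEz := congrFun hE z
  simp only [Pi.mul_apply, hE] at hmz
  rw [hE] at hDz
  simp only [Pi.sub_apply, Pi.smul_apply, smul_eq_mul] at hDz hmz hEz
  rw [normalizedDerivOfComplex, hsub.deriv] at hDz
  have h4 : ((normalizedDerivOfComplex E2 - (12 : ℂ)⁻¹ • (E2 * E2)) ∣[(4 : ℤ)] γ) z =
    (normalizedDerivOfComplex E2 ∣[(4 : ℤ)] γ) z - (12 : ℂ)⁻¹ * ((E2 * E2) ∣[(4 : ℤ)] γ) z := by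
    simp [ModularForm.SL_slash_apply]
    ring
  rw [h4, hmz]
  norm_num at hDz
  simp only [normalizedDerivOfComplex, Pi.sub_apply, Pi.smul_apply, smul_eq_mul, Pi.mul_apply]
  have hz := denom_ne_zero γ z
  simp only [D2, riemannZeta_two] at *
  rw [← sub_eq_iff_eq_add] at hDz
  rw [← hDz]
  clear hDz hmz hEz hsub hE2 hE hd h4 hm hD
  generalize denom _ _ = d at *
  generalize deriv (E2 ∘ ofComplex) (z : ℂ) = e at *
  generalize E2 z = x at *
  generalize ((γ 1 0 : ℤ) : ℂ) = c at *
  have hpi : (Real.pi : ℂ) ≠ 0 := by simp [Real.pi_ne_zero]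
  have hI : Complex.I ^ 2 = -1 := Complex.I_sq
  have hI0 : Complex.I ≠ 0 := Complex.I_ne_zero
  generalize Complex.I = i at *
  generalize (Real.pi : ℂ) = π at *
  field_simp
  ring_nf
  grind

/-- The base change of an integral power series to `ℂ`. -/
abbrev toC : PowerSeries ℤ →+* PowerSeries ℂ := PowerSeries.map (Int.castRingHom ℂ)

lemma goodQ_E2 : GoodQ E2 (toC (eisZ (-24) 1)) := by
  refine GoodQ.of_hasSum E2_mdifferentiable fun τ => ?_
  convert! hasSum_qExpansion_E2 (z := τ) using 2 with m
  · simp only [toC, eisZ, PowerSeries.coeff_map, PowerSeries.coeff_mk, Periodic.qParam,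
      Complex.ofReal_one, div_one]
    congr 1
    split_ifs
    · simp
    · simp [ArithmeticFunction.sigma_apply]

lemma goodQ_E {k : ℕ} (hk : 3 ≤ k) (hk2 : Even k) (c : ℤ)
    (hc : -(2 * k / bernoulli k : ℚ) = c) : GoodQ (E hk) (toC (eisZ c (k - 1))) where
  per := SlashInvariantFormClass.periodic_comp_ofComplex (E hk) one_mem_strictPeriods_SL
  hol := ModularFormClass.holo (E hk)
  bdd := ModularFormClass.bdd_at_infty (E hk)
  hq := by
    ext m
    rw [E_qExpansion_coeff hk hk2]
    simp only [toC, eisZ, PowerSeries.coeff_map, PowerSeries.coeff_mk]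
    have : -(2 * k / bernoulli k : ℂ) = c := by
      have := congrArg (Rat.cast (K := ℂ)) hc
      push_cast at this
      exact this
    rw [this]
    split_ifs
    · simp
    · simp [ArithmeticFunction.sigma_apply]

lemma goodQ_E4 : GoodQ E₄ (toC (eisZ 240 3)) :=
  goodQ_E (k := 4) (by norm_num) (by decide) 240 (by
    rw [show bernoulli 4 = -1/30 by decide +kernel]; norm_num)

lemma goodQ_E6 : GoodQ E₆ (toC (eisZ (-504) 5)) :=
  goodQ_E (k := 6) (by norm_num) (by decide) (-504) (by
    rw [show bernoulli 6 = 1/42 by decide +kernel]; norm_num)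

lemma slash_E4 (γ : SL(2, ℤ)) : (E₄ : ℍ → ℂ) ∣[(4 : ℤ)] γ = E₄ :=
  SlashInvariantFormClass.slash_action_eq E₄ _ ⟨γ, rfl⟩

lemma slash_E6 (γ : SL(2, ℤ)) : (E₆ : ℍ → ℂ) ∣[(6 : ℤ)] γ = E₆ :=
  SlashInvariantFormClass.slash_action_eq E₆ _ ⟨γ, rfl⟩

lemma slash_sub_smul (k : ℤ) (γ : SL(2, ℤ)) (f g : ℍ → ℂ) (c : ℂ) (hf : f ∣[k] γ = f)
    (hg : g ∣[k] γ = g) : (f - c • g) ∣[k] γ = f - c • g := by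
  ext z
  have h1 := congrFun hf z
  have h2 := congrFun hg z
  simp only [ModularForm.SL_slash_apply] at h1 h2 ⊢
  simp only [Pi.sub_apply, Pi.smul_apply, smul_eq_mul]
  rw [← h1, ← h2]
  ring

lemma toC_inj : Function.Injective toC :=
  PowerSeries.map_injective _ (fun a b h => by simpa using h)

lemma qd_toC (a : PowerSeries ℤ) : qd (toC a) = toC (qd a) := by
  ext n; simp [qd]

lemma toC_eis_zero (c : ℤ) (j : ℕ) : PowerSeries.constantCoeff (toC (eisZ c j)) = 1 := by
  rw [← PowerSeries.coeff_zero_eq_constantCoeff_apply, PowerSeries.coeff_map]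
  simp [eisZ]

lemma ramanujan2 : 12 * qd (eisZ (-24) 1) = eisZ (-24) 1 * eisZ (-24) 1 - eisZ 240 3 := by
  have h := (goodQ_E2.nderiv.sub ((goodQ_E2.mul goodQ_E2).smul (12 : ℂ)⁻¹)).sub
    (goodQ_E4.smul (-(12 : ℂ)⁻¹))
  have h0 := h.eq_zero 4 (by norm_num)
    (fun γ => slash_sub_smul 4 γ _ _ _ (E2_slash_aux γ) (slash_E4 γ))
    (by simp [qd, toC_eis_zero])
  apply toC_inj
  rw [qd_toC] at h0
  simp only [map_mul, map_sub, map_ofNat]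
  have := congrArg (fun x => (12 : ℂ) • x) h0
  simp only [smul_sub, smul_smul, smul_zero] at this
  norm_num at this
  rw [← sub_eq_zero, ← this]
  rw [show (12 : PowerSeries ℂ) = PowerSeries.C (12 : ℂ) from (map_ofNat PowerSeries.C 12).symm, PowerSeries.smul_eq_C_mul]
  ring

lemma ramanujan4 : 3 * qd (eisZ 240 3) = eisZ (-24) 1 * eisZ 240 3 - eisZ (-504) 5 := by
  have h := (goodQ_E4.nderiv.sub ((goodQ_E2.mul goodQ_E4).smul (3 : ℂ)⁻¹)).sub
    (goodQ_E6.smul (-(3 : ℂ)⁻¹))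
  have h0 := h.eq_zero 6 (by norm_num)
    (fun γ => slash_sub_smul 6 γ _ _ _ (by
      have := serreDerivative_slash_invariant (k := 4) goodQ_E4.hol (slash_E4 γ)
      convert! this using 1
      · congr 1
        ext z
        simp; ring
      · ext z
        simp; ring) (slash_E6 γ))
    (by simp [qd, toC_eis_zero])
  apply toC_inj
  rw [qd_toC] at h0
  simp only [map_mul, map_sub, map_ofNat]
  have := congrArg (fun x => (3 : ℂ) • x) h0
  simp only [smul_sub, smul_smul, smul_zero] at this
  norm_num at this
  rw [← sub_eq_zero, ← this]
  rw [show (3 : PowerSeries ℂ) = PowerSeries.C (3 : ℂ) from (map_ofNat PowerSeries.C 3).symm, PowerSeries.smul_eq_C_mul]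
  ring

lemma ramanujan6 : 2 * qd (eisZ (-504) 5) =
    eisZ (-24) 1 * eisZ (-504) 5 - eisZ 240 3 * eisZ 240 3 := by
  have h := (goodQ_E6.nderiv.sub ((goodQ_E2.mul goodQ_E6).smul (2 : ℂ)⁻¹)).sub
    ((goodQ_E4.mul goodQ_E4).smul (-(2 : ℂ)⁻¹))
  have h0 := h.eq_zero 8 (by norm_num)
    (fun γ => slash_sub_smul 8 γ _ _ _ (by
      have := serreDerivative_slash_invariant (k := 6) goodQ_E6.hol (slash_E6 γ)
      convert! this using 1
      · congr 1
        ext z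
        simp; ring
      · ext z
        simp; ring) (by
        have := ModularForm.mul_slash_SL2 4 4 γ E₄ E₄
        rw [slash_E4] at this
        exact this))
    (by simp [qd, toC_eis_zero])
  apply toC_inj
  rw [qd_toC] at h0
  simp only [map_mul, map_sub, map_ofNat]
  have := congrArg (fun x => (2 : ℂ) • x) h0
  simp only [smul_sub, smul_smul, smul_zero] at this
  norm_num at this
  rw [← sub_eq_zero, ← this]
  rw [show (2 : PowerSeries ℂ) = PowerSeries.C (2 : ℂ) from (map_ofNat PowerSeries.C 2).symm, PowerSeries.smul_eq_C_mul]
  ring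

end Analytic
section Alg

variable {S : Type} [CommRing S]

/-- The Ramanujan derivation over a ring, with `12 c = 1`. -/
def DG (c : S) : Derivation S (MvPolynomial (Fin 3) S) (MvPolynomial (Fin 3) S) :=
  (C c * (X 0 ^ 2 - X 1) : MvPolynomial (Fin 3) S) • pderiv 0 +
  (C (4 * c) * (X 0 * X 1 - X 2) : MvPolynomial (Fin 3) S) • pderiv 1 +
  (C (6 * c) * (X 0 * X 2 - X 1 ^ 2) : MvPolynomial (Fin 3) S) • pderiv 2

/-- The theta operator over a ring, with `12 c = 1`. -/
def TG (c : S) (A B : MvPolynomial (Fin 3) S) :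
    Derivation S (MvPolynomial (Fin 3) S) (MvPolynomial (Fin 3) S) :=
  (C (4 * c) * (B * X 1 - A * X 2) : MvPolynomial (Fin 3) S) • pderiv 1 +
  (C (6 * c) * (B * X 2 - A * X 1 ^ 2) : MvPolynomial (Fin 3) S) • pderiv 2

/-- The Euler derivation. -/
def EG (S : Type) [CommRing S] :
    Derivation S (MvPolynomial (Fin 3) S) (MvPolynomial (Fin 3) S) :=
  (C 2 * X 0 : MvPolynomial (Fin 3) S) • pderiv 0 +
  (C 4 * X 1 : MvPolynomial (Fin 3) S) • pderiv 1 +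
  (C 6 * X 2 : MvPolynomial (Fin 3) S) • pderiv 2

lemma DG_X0 (c : S) : DG c (X 0) = C c * (X 0 ^ 2 - X 1) := by
  simp [DG]
lemma DG_X1 (c : S) : DG c (X 1) = C (4 * c) * (X 0 * X 1 - X 2) := by
  simp [DG]
lemma DG_X2 (c : S) : DG c (X 2) = C (6 * c) * (X 0 * X 2 - X 1 ^ 2) := by
  simp [DG]
lemma TG_X0 (c : S) (A B) : TG c A B (X 0) = 0 := by
  simp [TG]
lemma TG_X1 (c : S) (A B) : TG c A B (X 1) = C (4 * c) * (B * X 1 - A * X 2) := by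
  simp [TG]
lemma TG_X2 (c : S) (A B) : TG c A B (X 2) = C (6 * c) * (B * X 2 - A * X 1 ^ 2) := by
  simp [TG]
lemma EG_X0 : EG S (X 0) = C 2 * X 0 := by simp [EG]
lemma EG_X1 : EG S (X 1) = C 4 * X 1 := by simp [EG]
lemma EG_X2 : EG S (X 2) = C 6 * X 2 := by simp [EG]


lemma der_C (d : Derivation S (MvPolynomial (Fin 3) S) (MvPolynomial (Fin 3) S)) (a : S) :
    d (C a) = 0 := d.map_algebraMap a

lemma der_2 (d : Derivation S (MvPolynomial (Fin 3) S) (MvPolynomial (Fin 3) S)) :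
    d 2 = 0 := by
  rw [show (2 : MvPolynomial (Fin 3) S) = (2 : ℕ) by norm_num, Derivation.map_natCast]

lemma der_4 (d : Derivation S (MvPolynomial (Fin 3) S) (MvPolynomial (Fin 3) S)) :
    d 4 = 0 := by
  rw [show (4 : MvPolynomial (Fin 3) S) = (4 : ℕ) by norm_num, Derivation.map_natCast]

lemma der_6 (d : Derivation S (MvPolynomial (Fin 3) S) (MvPolynomial (Fin 3) S)) :
    d 6 = 0 := by
  rw [show (6 : MvPolynomial (Fin 3) S) = (6 : ℕ) by norm_num, Derivation.map_natCast]

lemma EG_D (c : S) (f) : EG S (DG c f) = DG c (EG S f) + 2 * DG c f := by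
  have : ⁅EG S, DG c⁆ = (2 : MvPolynomial (Fin 3) S) • DG c := by
    refine MvPolynomial.derivation_ext fun i => ?_
    rw [Derivation.commutator_apply]
    fin_cases i <;>
    simp only [Fin.zero_eta, Fin.mk_one, Fin.reduceFinMk, Derivation.smul_apply, smul_eq_mul,
      DG_X0, DG_X1, DG_X2, EG_X0, EG_X1, EG_X2, Derivation.leibniz, Derivation.leibniz_pow,
      map_sub, der_C, der_2, der_4, der_6, map_mul, map_ofNat C] <;> norm_num <;> ring
  have := congrArg (fun d => d f) this
  simp only [Derivation.commutator_apply, Derivation.smul_apply, smul_eq_mul] at this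
  rw [← this]; ring

lemma d0_X0 : (pderiv 0 : Derivation S _ _) (X 0 : MvPolynomial (Fin 3) S) = 1 := by simp
lemma d0_X1 : (pderiv 0 : Derivation S _ _) (X 1 : MvPolynomial (Fin 3) S) = 0 := by simp
lemma d0_X2 : (pderiv 0 : Derivation S _ _) (X 2 : MvPolynomial (Fin 3) S) = 0 := by simp

lemma d0_D (c : S) (f) : pderiv 0 (DG c f) = DG c (pderiv 0 f) + C c * EG S f := by
  have : ⁅(pderiv 0 : Derivation S (MvPolynomial (Fin 3) S) (MvPolynomial (Fin 3) S)), DG c⁆ =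
      (C c : MvPolynomial (Fin 3) S) • EG S := by
    refine MvPolynomial.derivation_ext fun i => ?_
    rw [Derivation.commutator_apply]
    fin_cases i <;>
    simp only [Fin.zero_eta, Fin.mk_one, Fin.reduceFinMk, Derivation.smul_apply, smul_eq_mul,
      DG_X0, DG_X1, DG_X2, EG_X0, EG_X1, EG_X2, d0_X0, d0_X1, d0_X2,
      Derivation.leibniz, Derivation.leibniz_pow,
      map_sub, der_C, der_2, der_4, der_6, map_mul, map_ofNat C, map_one, map_zero, Derivation.map_one_eq_zero] <;>
      norm_num <;> ring
  have := congrArg (fun d => d f) this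
  simp only [Derivation.commutator_apply, Derivation.smul_apply, smul_eq_mul] at this
  rw [← this]; ring

lemma d0_T (c : S) (A B f) (hA : pderiv 0 A = 0) (hB : pderiv 0 B = 0) :
    pderiv 0 (TG c A B f) = TG c A B (pderiv 0 f) := by
  have : ⁅(pderiv 0 : Derivation S (MvPolynomial (Fin 3) S) (MvPolynomial (Fin 3) S)),
      TG c A B⁆ = 0 := by
    refine MvPolynomial.derivation_ext fun i => ?_
    rw [Derivation.commutator_apply]
    fin_cases i <;>
    simp only [Fin.zero_eta, Fin.mk_one, Fin.reduceFinMk, Derivation.smul_apply, smul_eq_mul,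
      TG_X0, TG_X1, TG_X2, d0_X0, d0_X1, d0_X2, hA, hB, Derivation.zero_apply,
      Derivation.leibniz, Derivation.leibniz_pow,
      map_sub, der_C, der_2, der_4, der_6, map_mul, map_ofNat C, map_one, map_zero, Derivation.map_one_eq_zero] <;>
      norm_num
  have := congrArg (fun d => d f) this
  simp only [Derivation.commutator_apply, Derivation.zero_apply] at this
  exact sub_eq_zero.mp this

lemma EG_T (c : S) (A B f) (p : ℕ) (hA : EG S A = (p - 1 : MvPolynomial (Fin 3) S) * A)
    (hB : EG S B = (p + 1 : MvPolynomial (Fin 3) S) * B) :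
    EG S (TG c A B f) = TG c A B (EG S f) + (p + 1) * TG c A B f := by
  have : ⁅EG S, TG c A B⁆ = (p + 1 : MvPolynomial (Fin 3) S) • TG c A B := by
    refine MvPolynomial.derivation_ext fun i => ?_
    rw [Derivation.commutator_apply]
    fin_cases i <;>
    simp only [Fin.zero_eta, Fin.mk_one, Fin.reduceFinMk, Derivation.smul_apply, smul_eq_mul,
      TG_X0, TG_X1, TG_X2, EG_X0, EG_X1, EG_X2, hA, hB, Derivation.leibniz, Derivation.leibniz_pow,
      map_sub, der_C, der_2, der_4, der_6, map_mul, map_ofNat C, map_zero] <;> norm_num <;> ring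
  have := congrArg (fun d => d f) this
  simp only [Derivation.commutator_apply, Derivation.smul_apply, smul_eq_mul] at this
  rw [← this]; ring

lemma EG_iter (c : S) (f) (k n : ℕ) (hf : EG S f = k * f) :
    EG S ((DG c)^[n] f) = (k + 2 * n : MvPolynomial (Fin 3) S) * (DG c)^[n] f := by
  induction n with
  | zero => simp [hf]
  | succ n ih =>
    rw [Function.iterate_succ_apply', EG_D, ih, Derivation.leibniz]
    have : DG c (k + 2 * n : MvPolynomial (Fin 3) S) = 0 := by
      have h : (k + 2 * n : MvPolynomial (Fin 3) S) = ((k + 2 * n : ℕ) : MvPolynomial (Fin 3) S) := by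
        push_cast; ring
      rw [h, Derivation.map_natCast]
    rw [this]; push_cast; simp only [smul_eq_mul]; ring

lemma d0_iter (c : S) (f) (k n : ℕ) (hf : EG S f = k * f) (h0 : pderiv 0 f = 0) :
    pderiv 0 ((DG c)^[n + 1] f) =
      (((n + 1) * (k + n) : ℕ) : MvPolynomial (Fin 3) S) * (C c * (DG c)^[n] f) := by
  induction n with
  | zero => simp [d0_D, h0, hf]; ring
  | succ n ih =>
    rw [Function.iterate_succ_apply', d0_D, ih, EG_iter c f k _ hf, Derivation.leibniz,
      Derivation.leibniz, Derivation.map_natCast, der_C, Function.iterate_succ_apply']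
    push_cast; simp only [smul_eq_mul]; ring

lemma d0_iter_m (c : S) (f) (k n m : ℕ) (hf : EG S f = k * f) (h0 : pderiv 0 f = 0) (hm : m ≤ n) :
    (pderiv 0)^[m] ((DG c)^[n] f) =
      C ((m.factorial : S) * (n.choose m) * (∏ i ∈ Finset.range m, ((k + n - 1 - i : ℕ) : S)) * c ^ m)
       * (DG c)^[n - m] f := by
  induction m with
  | zero => simp
  | succ m ih =>
    obtain ⟨l, rfl⟩ : ∃ l, n = m + 1 + l := ⟨n - (m + 1), by omega⟩
    rw [Function.iterate_succ_apply', ih (by omega), Derivation.leibniz, der_C,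
      show m + 1 + l - m = l + 1 by omega, d0_iter c f k l hf h0,
      show m + 1 + l - (m + 1) = l by omega, Finset.prod_range_succ,
      show k + (m + 1 + l) - 1 - m = k + l by omega]
    have h1 : ((m + 1 + l).choose m : S) * (l + 1) = (m + 1 + l).choose (m + 1) * (m + 1) := by
      have := Nat.choose_succ_right_eq (m + 1 + l) m
      rw [show m + 1 + l - m = l + 1 by omega] at this
      have := congrArg (Nat.cast (R := S)) this
      push_cast at this
      exact this.symm
    rw [Nat.factorial_succ]
    have h2 : (((l + 1) * (k + l) : ℕ) : MvPolynomial (Fin 3) S) = C (((l + 1) * (k + l) : ℕ) : S) := by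
      simp
    rw [h2]
    simp only [smul_eq_mul]
    rw [← mul_assoc, ← mul_assoc, ← map_mul, ← map_mul, mul_zero, add_zero]
    congr 2
    push_cast
    linear_combination (m.factorial * (∏ x ∈ range m, ((k + (m + 1 + l) - 1 - x : ℕ) : S)) *
      c ^ (m + 1) * (k + l)) * h1

lemma coeff_d0_iter (f : MvPolynomial (Fin 3) S) (m : ℕ) (μ : Fin 3 →₀ ℕ) :
    coeff μ ((pderiv 0)^[m] f) =
      ((μ 0 + m).descFactorial m : S) * coeff (μ + Finsupp.single 0 m) f := by
  induction m generalizing μ with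
  | zero => simp
  | succ m ih =>
    rw [Function.iterate_succ_apply', coeff_pderiv, ih, Nat.descFactorial_succ, add_assoc,
      ← Finsupp.single_add, add_comm 1 m]
    simp only [Finsupp.add_apply, Finsupp.single_eq_same]
    rw [show μ 0 + (m + 1) - m = μ 0 + 1 by omega, show μ 0 + 1 + m = μ 0 + (m + 1) by omega]
    push_cast; ring

lemma coeff_EG (f : MvPolynomial (Fin 3) S) (μ : Fin 3 →₀ ℕ) :
    coeff μ (EG S f) = ((2 * μ 0 + 4 * μ 1 + 6 * μ 2 : ℕ) : S) * coeff μ f := by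
  induction f using MvPolynomial.induction_on' with
  | add f g hf hg => simp only [map_add, coeff_add, hf, hg]; ring
  | monomial ν a =>
    have hX : ∀ i : Fin 3, (X i : MvPolynomial (Fin 3) S) * pderiv i (monomial ν a) =
        C (ν i : S) * monomial ν a := by
      intro i
      rw [X_mul_pderiv_monomial, nsmul_eq_mul]
      simp
    have : EG S (monomial ν a) = C (((2 * ν 0 + 4 * ν 1 + 6 * ν 2 : ℕ) : S)) * monomial ν a := by
      simp only [EG, Derivation.add_apply, Derivation.smul_apply, smul_eq_mul, mul_assoc, hX]
      push_cast
      simp only [map_add, map_mul]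
      ring
    rw [this, coeff_C_mul]
    simp only [coeff_monomial]
    split_ifs with h
    · rw [h]
    · simp

variable [IsDomain S] [CharZero S]

lemma EG_of_iso (f : MvPolynomial (Fin 3) S) (k : ℕ)
    (h : ∀ μ, coeff μ f ≠ 0 → 2 * μ 0 + 4 * μ 1 + 6 * μ 2 = k) : EG S f = k * f := by
  ext μ
  rw [coeff_EG, show (k : MvPolynomial (Fin 3) S) = C (k : S) by simp, coeff_C_mul]
  by_cases h0 : coeff μ f = 0
  · simp [h0]
  · rw [h μ h0]

lemma iso_of_EG (f : MvPolynomial (Fin 3) S) (k : ℕ) (h : EG S f = k * f) (μ) (h0 : coeff μ f ≠ 0) :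
    2 * μ 0 + 4 * μ 1 + 6 * μ 2 = k := by
  have h1 := congrArg (coeff μ) h
  rw [coeff_EG, show (k : MvPolynomial (Fin 3) S) = C (k : S) by simp, coeff_C_mul] at h1
  exact_mod_cast mul_right_cancel₀ h0 h1

lemma d0_of_noP (f : MvPolynomial (Fin 3) S) (h : ∀ μ, coeff μ f ≠ 0 → μ 0 = 0) :
    pderiv 0 f = 0 := by
  ext μ
  rw [coeff_pderiv]
  by_cases h0 : coeff (μ + Finsupp.single 0 1) f = 0
  · simp [h0]
  · have := h _ h0
    simp at this

lemma noP_of_d0 (f : MvPolynomial (Fin 3) S) (h : pderiv 0 f = 0) (μ) (h0 : coeff μ f ≠ 0) :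
    μ 0 = 0 := by
  by_contra hμ
  have h1 := congrArg (coeff (μ - Finsupp.single 0 1)) h
  rw [coeff_pderiv] at h1
  have : μ - Finsupp.single 0 1 + Finsupp.single 0 1 = μ := by
    ext i
    by_cases hi : i = 0
    · subst hi; simp; omega
    · simp [Ne.symm hi]
  rw [this] at h1
  simp only [coeff_zero, mul_eq_zero, h0, false_or] at h1
  exact (Nat.cast_add_one_ne_zero _ h1)

/-- `D^p F` only involves `P` with coefficients divisible by `p`. -/
lemma coeff_Dp (c : S) (f) (k p : ℕ) (hp : p.Prime) (hf : EG S f = k * f) (h0 : pderiv 0 f = 0)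
    (μ : Fin 3 →₀ ℕ) (hμ : μ 0 ≠ 0) : (p : S) ∣ coeff μ ((DG c)^[p] f) := by
  set m := μ 0 with hm
  set ν := μ - Finsupp.single 0 m with hν
  have hνμ : ν + Finsupp.single 0 m = μ := by
    ext i
    by_cases hi : i = 0
    · subst hi; simp [hν, hm]
    · simp [hν, Ne.symm hi]
  have hν0 : ν 0 = 0 := by simp [hν, hm]
  have h1 := coeff_d0_iter ((DG c)^[p] f) m ν
  rw [hνμ, hν0, zero_add, Nat.descFactorial_self] at h1
  have hfac : (m.factorial : S) ≠ 0 := by exact_mod_cast m.factorial_ne_zero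
  by_cases hmp : m ≤ p
  · rw [d0_iter_m c f k p m hf h0 hmp, coeff_C_mul] at h1
    have h2 : coeff μ ((DG c)^[p] f) = (p.choose m) *
        (∏ i ∈ Finset.range m, ((k + p - 1 - i : ℕ) : S)) * c ^ m * coeff ν ((DG c)^[p - m] f) := by
      apply mul_left_cancel₀ hfac
      rw [← h1]; ring
    rw [h2]
    refine Dvd.dvd.mul_right (Dvd.dvd.mul_right ?_ _) _
    by_cases hmp' : m = p
    · apply Dvd.dvd.mul_left
      rw [← Nat.cast_prod]
      apply Nat.cast_dvd_cast
      rw [hmp', ← Nat.descFactorial_eq_prod_range]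
      exact dvd_trans (Nat.dvd_factorial hp.pos le_rfl) (Nat.factorial_dvd_descFactorial _ _)
    · apply Dvd.dvd.mul_right
      exact Nat.cast_dvd_cast (hp.dvd_choose_self hμ (by omega))
  · obtain ⟨l, hl⟩ : ∃ l, m = l + 1 + p := ⟨m - p - 1, by omega⟩
    have h3 : (pderiv 0)^[m] ((DG c)^[p] f) = 0 := by
      rw [hl, Function.iterate_add_apply, d0_iter_m c f k p p hf h0 le_rfl,
        Function.iterate_succ_apply, Derivation.leibniz, der_C]
      simp [h0]
    rw [h3, coeff_zero] at h1
    have := (mul_eq_zero.mp h1.symm).resolve_left hfac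
    rw [this]; exact dvd_zero _

end Alg
section Inj

variable {K : Type} [Field K]

lemma qd_eq {R : Type} [CommRing R] (f : PowerSeries R) :
    qd f = PowerSeries.X * PowerSeries.derivative R f := by
  ext n
  cases n with
  | zero => simp [qd]
  | succ n =>
    rw [PowerSeries.coeff_succ_X_mul]
    simp [qd, PowerSeries.coeff_derivative]
    ring

lemma qd_mul {R : Type} [CommRing R] (f g : PowerSeries R) : qd (f * g) = qd f * g + f * qd g := by
  simp only [qd_eq, Derivation.leibniz, smul_eq_mul]; ring

lemma qd_add {R : Type} [CommRing R] (f g : PowerSeries R) : qd (f + g) = qd f + qd g := by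
  simp only [qd_eq, map_add]; ring

lemma qd_aeval {R : Type} [CommRing R] (x : Fin 3 → PowerSeries R) (f : MvPolynomial (Fin 3) R) :
    qd (aeval x f) = aeval x (pderiv 0 f) * qd (x 0) + aeval x (pderiv 1 f) * qd (x 1) +
      aeval x (pderiv 2 f) * qd (x 2) := by
  induction f using MvPolynomial.induction_on with
  | C a =>
    simp [qd_eq]
  | add f g hf hg => simp only [map_add, qd_add, hf, hg]; ring
  | mul_X f i hf =>
    rw [map_mul, qd_mul, hf]
    fin_cases i <;> simp <;> ring

lemma j_transc (j : PowerSeries K) (h1 : PowerSeries.constantCoeff j = 1) (hj : j ≠ 1)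
    (h : Polynomial K) (h0 : Polynomial.aeval j h = 0) : h = 0 := by
  by_contra hne
  obtain ⟨q, hq, hnd⟩ := Polynomial.exists_eq_pow_rootMultiplicity_mul_and_not_dvd h hne 1
  rw [hq, map_mul, map_pow] at h0
  have hs : Polynomial.aeval j (Polynomial.X - Polynomial.C (1 : K)) ≠ 0 := by
    simpa [sub_eq_zero] using hj
  have hq0 := (mul_eq_zero.mp h0).resolve_left (pow_ne_zero _ hs)
  apply hnd
  rw [Polynomial.dvd_iff_isRoot, Polynomial.IsRoot.def]
  have := congrArg PowerSeries.constantCoeff hq0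
  rw [Polynomial.aeval_def, Polynomial.hom_eval₂, h1, map_zero] at this
  have hid : (PowerSeries.constantCoeff (R := K)).comp (algebraMap K (PowerSeries K)) =
      RingHom.id K := by
    ext a; simp
  rw [hid] at this
  exact this

lemma phi_inj (x : Fin 3 → PowerSeries K) (h1 : PowerSeries.constantCoeff (x 1) = 1)
    (h2 : PowerSeries.constantCoeff (x 2) = 1) (hx : x 1 ^ 3 ≠ x 2 ^ 2)
    (f : MvPolynomial (Fin 3) K) (w : ℕ)
    (hf : ∀ μ, coeff μ f ≠ 0 → μ 0 = 0 ∧ 2 * μ 0 + 4 * μ 1 + 6 * μ 2 = w)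
    (h0 : aeval x f = 0) : f = 0 := by
  set l := x 1 * (x 2)⁻¹ with hl
  set j := x 1 ^ 3 * (x 2)⁻¹ ^ 2 with hj
  have hinv : x 2 * (x 2)⁻¹ = 1 := PowerSeries.mul_inv_cancel _ (by simp [h2])
  have hc : PowerSeries.constantCoeff j = 1 := by simp [hj, h1, h2]
  have hj1 : j ≠ 1 := by
    intro h
    apply hx
    calc x 1 ^ 3 = x 1 ^ 3 * (x 2 * (x 2)⁻¹) ^ 2 := by rw [hinv]; ring
      _ = j * x 2 ^ 2 := by rw [hj]; ring
      _ = _ := by rw [h, one_mul]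
  have hl1 : x 1 * l ^ 2 = j := by rw [hl, hj]; ring
  have hl2 : x 2 * l ^ 3 = j := by
    calc x 2 * l ^ 3 = (x 2 * (x 2)⁻¹) * j := by rw [hl, hj]; ring
      _ = j := by rw [hinv, one_mul]
  let h : Polynomial K := aeval ![0, Polynomial.X, Polynomial.X] f
  have hh : h = ∑ μ ∈ f.support, Polynomial.C (coeff μ f) * Polynomial.X ^ (μ 1 + μ 2) := by
    simp only [h, aeval_def, eval₂_eq', Fin.prod_univ_three]
    refine Finset.sum_congr rfl fun μ hμ => ?_
    have := (hf μ (mem_support_iff.mp hμ)).1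
    simp [this, pow_add]
  have hz : Polynomial.aeval j h = 0 := by
    have : Polynomial.aeval j h = l ^ (w / 2) * aeval x f := by
      rw [hh, map_sum]
      simp only [aeval_def, eval₂_eq', Fin.prod_univ_three, Finset.mul_sum]
      refine Finset.sum_congr rfl fun μ hμ => ?_
      obtain ⟨ha, hb⟩ := hf μ (mem_support_iff.mp hμ)
      have hw : w / 2 = 2 * μ 1 + 3 * μ 2 := by omega
      rw [hw, ha]
      simp only [map_mul, map_pow, Polynomial.aeval_C, Polynomial.aeval_X]
      rw [pow_add j]
      nth_rewrite 1 [← hl1]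
      rw [← hl2]
      ring
    rw [this, h0, mul_zero]
  have hzero := j_transc j hc hj1 h hz
  ext μ
  rw [coeff_zero]
  by_contra hne
  have h3 := congrArg (Polynomial.coeff · (μ 1 + μ 2)) (hh.symm.trans hzero)
  simp only [Polynomial.finsetSum_coeff, Polynomial.coeff_C_mul, Polynomial.coeff_X_pow,
    Polynomial.coeff_zero] at h3
  rw [Finset.sum_eq_single μ] at h3
  · simp at h3; exact hne h3
  · intro ν hν hνμ
    rw [if_neg, mul_zero]
    intro heq
    apply hνμ
    obtain ⟨ha, hb⟩ := hf μ hne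
    obtain ⟨ha', hb'⟩ := hf ν (mem_support_iff.mp hν)
    ext i
    fin_cases i <;> simp <;> omega
  · intro hn
    exact absurd (mem_support_iff.mpr hne) hn

end Inj
section Main

/-- The reductions of `E₂, E₄, E₆` modulo `p`. -/
def xK (p : ℕ) : Fin 3 → PowerSeries (ZMod p) :=
  fun i => PowerSeries.map (Int.castRingHom (ZMod p)) (![eisZ (-24) 1, eisZ 240 3, eisZ (-504) 5] i)

lemma qd_map (p : ℕ) (f : PowerSeries ℤ) : qd (PowerSeries.map (Int.castRingHom (ZMod p)) f) =
    PowerSeries.map (Int.castRingHom (ZMod p)) (qd f) := by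
  ext n; simp [qd]

lemma ram0 (p : ℕ) : 12 * qd (xK p 0) = xK p 0 ^ 2 - xK p 1 := by
  have := congrArg (PowerSeries.map (Int.castRingHom (ZMod p))) ramanujan2
  simp only [map_mul, map_sub, map_ofNat, ← qd_map] at this
  simpa [xK, pow_two] using this

lemma ram1 (p : ℕ) : 3 * qd (xK p 1) = xK p 0 * xK p 1 - xK p 2 := by
  have := congrArg (PowerSeries.map (Int.castRingHom (ZMod p))) ramanujan4
  simp only [map_mul, map_sub, map_ofNat, ← qd_map] at this
  simpa [xK, pow_two] using this

lemma ram2 (p : ℕ) : 2 * qd (xK p 2) = xK p 0 * xK p 2 - xK p 1 ^ 2 := by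
  have := congrArg (PowerSeries.map (Int.castRingHom (ZMod p))) ramanujan6
  simp only [map_mul, map_sub, map_ofNat, ← qd_map] at this
  simpa [xK, pow_two] using this

lemma xK_const (p : ℕ) (i) : PowerSeries.constantCoeff (xK p i) = 1 := by
  rw [← PowerSeries.coeff_zero_eq_constantCoeff_apply, xK, PowerSeries.coeff_map]
  fin_cases i <;> simp [eisZ]

lemma xK_ne (p : ℕ) [hp : Fact p.Prime] (hp5 : 5 ≤ p) : xK p 1 ^ 3 ≠ xK p 2 ^ 2 := by
  intro h
  have h1 : PowerSeries.coeff 1 (xK p 1) = 240 := by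
    simp [xK, eisZ]
  have h2 : PowerSeries.coeff 1 (xK p 2) = -504 := by
    simp [xK, eisZ]
  have := congrArg (PowerSeries.coeff 1) h
  simp only [pow_succ, pow_zero, one_mul, PowerSeries.coeff_one_mul, h1, h2, xK_const, map_mul] at this
  have h3 : ((1728 : ℕ) : ZMod p) = 0 := by push_cast; linear_combination this
  rw [ZMod.natCast_eq_zero_iff, show 1728 = 2 ^ 6 * 3 ^ 3 by norm_num] at h3
  rcases hp.out.dvd_mul.mp h3 with h | h
  · have := Nat.le_of_dvd (by norm_num) (hp.out.dvd_of_dvd_pow h); omega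
  · have := Nat.le_of_dvd (by norm_num) (hp.out.dvd_of_dvd_pow h); omega

lemma C_eq {R : Type} [CommRing R] (a : R) (g : Fin 3 → PowerSeries R) :
    aeval g (C a : MvPolynomial (Fin 3) R) = PowerSeries.C a := by
  rw [aeval_C]; rfl

lemma phi_D (p : ℕ) (c : ZMod p) (hc : 12 * c = 1) (f) :
    aeval (xK p) (DG c f) = qd (aeval (xK p) f) := by
  rw [qd_aeval]
  simp only [DG, Derivation.add_apply, Derivation.smul_apply, smul_eq_mul, map_add, map_mul,
    map_sub, map_pow, C_eq, aeval_X, ← ram0, ← ram1, ← ram2, map_ofNat]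
  have h : 12 * PowerSeries.C c = (1 : PowerSeries (ZMod p)) := by
    have := congrArg (PowerSeries.C (R := ZMod p)) hc
    simpa only [map_mul, map_one, map_ofNat] using this
  linear_combination (aeval (xK p) (pderiv 0 f) * qd (xK p 0) + aeval (xK p) (pderiv 1 f) * qd (xK p 1) +
      aeval (xK p) (pderiv 2 f) * qd (xK p 2)) * h

lemma phi_T (p : ℕ) (c : ZMod p) (hc : 12 * c = 1) (A B f) (hA : aeval (xK p) A = 1)
    (hB : aeval (xK p) B = xK p 0) (hf : pderiv 0 f = 0) :
    aeval (xK p) (TG c A B f) = qd (aeval (xK p) f) := by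
  rw [← phi_D p c hc]
  simp [DG, TG, hf, hA, hB]

lemma qd_iter (p : ℕ) [Fact p.Prime] (f : PowerSeries (ZMod p)) : qd^[p] f = qd f := by
  have : ∀ n m, PowerSeries.coeff m (qd^[n] f) = (m : ZMod p) ^ n * PowerSeries.coeff m f := by
    intro n
    induction n with
    | zero => simp
    | succ n ih => intro m; rw [Function.iterate_succ_apply']; simp [qd, ih]; ring
  ext m
  rw [this, ZMod.pow_card]
  simp [qd]

variable {S : Type} [CommRing S]

lemma map_D {K : Type} [CommRing K] (φ : S →+* K) (c : S) (f) :
    map φ (DG c f) = DG (φ c) (map φ f) := by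
  have h4 : φ 4 = 4 := map_ofNat φ 4
  have h6 : φ 6 = 6 := map_ofNat φ 6
  simp [DG, pderiv_map, h4, h6]

lemma map_D_iter {K : Type} [CommRing K] (φ : S →+* K) (c : S) (f) (n : ℕ) :
    map φ ((DG c)^[n] f) = (DG (φ c))^[n] (map φ f) := by
  induction n with
  | zero => rfl
  | succ n ih => rw [Function.iterate_succ_apply', Function.iterate_succ_apply', map_D, ih]

lemma map_T {K : Type} [CommRing K] (φ : S →+* K) (c : S) (A B f) :
    map φ (TG c A B f) = TG (φ c) (map φ A) (map φ B) (map φ f) := by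
  have h4 : φ 4 = 4 := map_ofNat φ 4
  have h6 : φ 6 = 6 := map_ofNat φ 6
  simp [TG, pderiv_map, h4, h6]

lemma phi_D_iter (p : ℕ) (c : ZMod p) (hc : 12 * c = 1) (f) (n : ℕ) :
    aeval (xK p) ((DG c)^[n] f) = qd^[n] (aeval (xK p) f) := by
  induction n with
  | zero => rfl
  | succ n ih => rw [Function.iterate_succ_apply', Function.iterate_succ_apply', phi_D p c hc, ih]

variable [IsDomain S] [CharZero S]

lemma step (p : ℕ) [hp : Fact p.Prime] (hp5 : 5 ≤ p) (φ : S →+* ZMod p) (c : S) (hc : 12 * c = 1)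
    (A B : MvPolynomial (Fin 3) S) (hA : EG S A = (p - 1 : MvPolynomial (Fin 3) S) * A)
    (hB : EG S B = (p + 1 : MvPolynomial (Fin 3) S) * B) (hA0 : pderiv 0 A = 0)
    (hB0 : pderiv 0 B = 0) (hAΦ : aeval (xK p) (map φ A) = 1)
    (hBΦ : aeval (xK p) (map φ B) = xK p 0)
    (k : ℕ) (F : MvPolynomial (Fin 3) S) (hF : EG S F = k * F) (hF0 : pderiv 0 F = 0) :
    map φ ((DG c)^[p] F) = map φ (A * TG c A B F) := by
  have hc' : 12 * φ c = 1 := by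
    have := congrArg φ hc
    simpa only [map_mul, map_one, map_ofNat] using this
  have hTE : EG S (TG c A B F) = (k + p + 1 : MvPolynomial (Fin 3) S) * TG c A B F := by
    rw [EG_T c A B F p hA hB, hF, Derivation.leibniz, Derivation.map_natCast]
    simp only [smul_eq_mul]; ring
  have hT0 : pderiv 0 (TG c A B F) = 0 := by
    rw [d0_T c A B F hA0 hB0, hF0, map_zero]
  have h1E : EG S ((DG c)^[p] F) = ((k + 2 * p : ℕ) : MvPolynomial (Fin 3) S) * (DG c)^[p] F := by
    rw [EG_iter c F k p hF]; push_cast; ring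
  have h2E : EG S (A * TG c A B F) = ((k + 2 * p : ℕ) : MvPolynomial (Fin 3) S) * (A * TG c A B F) := by
    rw [Derivation.leibniz, hA, hTE]; simp only [smul_eq_mul]; push_cast; ring
  have h20 : pderiv 0 (A * TG c A B F) = 0 := by
    rw [Derivation.leibniz, hA0, hT0]; simp
  rw [← sub_eq_zero]
  refine phi_inj (xK p) (xK_const p 1) (xK_const p 2) (xK_ne p hp5) _ (k + 2 * p) ?_ ?_
  · intro μ hμ
    rw [coeff_sub, coeff_map, coeff_map] at hμ
    by_cases h1 : φ (coeff μ ((DG c)^[p] F)) = 0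
    · have h2 : coeff μ (A * TG c A B F) ≠ 0 := by
        intro h; rw [h1, h] at hμ; simp at hμ
      exact ⟨noP_of_d0 _ h20 _ h2, iso_of_EG _ _ h2E _ h2⟩
    · refine ⟨?_, iso_of_EG _ _ h1E _ (fun h => h1 (by rw [h, map_zero]))⟩
      by_contra h0
      obtain ⟨y, hy⟩ := coeff_Dp c F k p hp.out hF hF0 μ h0
      apply h1
      rw [hy, map_mul, map_natCast, CharP.cast_eq_zero, zero_mul]
  · have hF0' : pderiv 0 (map φ F) = 0 := by rw [pderiv_map, hF0, map_zero]
    rw [map_sub, map_D_iter, phi_D_iter p _ hc', qd_iter, map_mul, map_mul, hAΦ, map_T,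
      phi_T p _ hc' _ _ _ hAΦ hBΦ hF0', one_mul, sub_self]

lemma theta_A (p : ℕ) [hp : Fact p.Prime] (hp5 : 5 ≤ p) (φ : S →+* ZMod p) (c : S) (hc : 12 * c = 1)
    (A B : MvPolynomial (Fin 3) S) (hA : EG S A = (p - 1 : MvPolynomial (Fin 3) S) * A)
    (hB : EG S B = (p + 1 : MvPolynomial (Fin 3) S) * B) (hA0 : pderiv 0 A = 0)
    (hB0 : pderiv 0 B = 0) (hAΦ : aeval (xK p) (map φ A) = 1)
    (hBΦ : aeval (xK p) (map φ B) = xK p 0) :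
    map φ (TG c A B A) = 0 := by
  have hc' : 12 * φ c = 1 := by
    have := congrArg φ hc
    simpa only [map_mul, map_one, map_ofNat] using this
  have hTE : EG S (TG c A B A) = ((2 * p : ℕ) : MvPolynomial (Fin 3) S) * TG c A B A := by
    rw [EG_T c A B A p hA hB, hA, Derivation.leibniz, map_sub, Derivation.map_natCast,
      Derivation.map_one_eq_zero]
    simp only [smul_eq_mul]; push_cast; ring
  have hT0 : pderiv 0 (TG c A B A) = 0 := by
    rw [d0_T c A B A hA0 hB0, hA0, map_zero]
  refine phi_inj (xK p) (xK_const p 1) (xK_const p 2) (xK_ne p hp5) _ (2 * p) ?_ ?_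
  · intro μ hμ
    rw [coeff_map] at hμ
    have h2 : coeff μ (TG c A B A) ≠ 0 := fun h => hμ (by rw [h, map_zero])
    exact ⟨noP_of_d0 _ hT0 _ h2, iso_of_EG _ _ hTE _ h2⟩
  · rw [map_T, phi_T p _ hc' _ _ _ hAΦ hBΦ (by rw [pderiv_map, hA0, map_zero]), hAΦ]
    simp [qd_eq]

lemma main_S (p : ℕ) [hp : Fact p.Prime] (hp5 : 5 ≤ p) (φ : S →+* ZMod p) (c : S) (hc : 12 * c = 1)
    (A B : MvPolynomial (Fin 3) S) (hA : EG S A = (p - 1 : MvPolynomial (Fin 3) S) * A)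
    (hB : EG S B = (p + 1 : MvPolynomial (Fin 3) S) * B) (hA0 : pderiv 0 A = 0)
    (hB0 : pderiv 0 B = 0) (hAΦ : aeval (xK p) (map φ A) = 1)
    (hBΦ : aeval (xK p) (map φ B) = xK p 0)
    (k : ℕ) (F : MvPolynomial (Fin 3) S) (hF : EG S F = k * F) (hF0 : pderiv 0 F = 0) (r : ℕ) :
    map φ ((DG c)^[r * p] F) = map φ (A ^ r * (TG c A B)^[r] F) := by
  have hT : ∀ r : ℕ, EG S ((TG c A B)^[r] F) =
      ((k + r * (p + 1) : ℕ) : MvPolynomial (Fin 3) S) * (TG c A B)^[r] F ∧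
      pderiv 0 ((TG c A B)^[r] F) = 0 := by
    intro r
    induction r with
    | zero => simp [hF, hF0]
    | succ r ih =>
      rw [Function.iterate_succ_apply', d0_T c A B _ hA0 hB0, ih.2, map_zero,
        EG_T c A B _ p hA hB, ih.1, Derivation.leibniz, Derivation.map_natCast]
      refine ⟨?_, rfl⟩
      simp only [smul_eq_mul]; push_cast; ring
  have hAr : ∀ r : ℕ, EG S (A ^ r) = ((r * (p - 1) : ℕ) : MvPolynomial (Fin 3) S) * A ^ r ∧
      pderiv 0 (A ^ r) = 0 := by
    intro r
    induction r with
    | zero => simp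
    | succ r ih =>
      rw [pow_succ, Derivation.leibniz, Derivation.leibniz, ih.1, ih.2, hA, hA0]
      refine ⟨?_, by simp⟩
      rw [Nat.cast_mul, Nat.cast_mul, Nat.cast_sub hp.out.one_le]
      simp only [smul_eq_mul]; push_cast; ring
  have hTA := theta_A p hp5 φ c hc A B hA hB hA0 hB0 hAΦ hBΦ
  have hTAr : ∀ r : ℕ, map φ (TG c A B (A ^ r)) = 0 := by
    intro r
    rw [Derivation.leibniz_pow, map_nsmul, smul_eq_mul, map_mul, hTA]; simp
  induction r with
  | zero => simp
  | succ r ih =>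
    have h1 : map φ ((DG c)^[p] ((DG c)^[r * p] F)) =
        map φ ((DG c)^[p] (A ^ r * (TG c A B)^[r] F)) := by
      rw [map_D_iter, ih, ← map_D_iter]
    rw [show (r + 1) * p = p + r * p by ring, Function.iterate_add_apply, h1,
      step p hp5 φ c hc A B hA hB hA0 hB0 hAΦ hBΦ (r * (p - 1) + (k + r * (p + 1)))
        (A ^ r * (TG c A B)^[r] F) ?_ ?_, Derivation.leibniz, Function.iterate_succ_apply']
    · simp only [map_mul, map_add, hTAr, smul_eq_mul, mul_zero, add_zero, map_pow]
      ring
    · rw [Derivation.leibniz, (hAr r).1, (hT r).1]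
      simp only [smul_eq_mul]; push_cast; ring
    · rw [Derivation.leibniz, (hAr r).2, (hT r).2]; simp

end Main
section Local

variable (p : ℕ) [hp : Fact p.Prime]

/-- The ring `ℤ_(p)` as a subring of `ℚ`. -/
def Zp : Subring ℚ := (PadicInt.subring p).comap (Rat.castHom ℚ_[p])

lemma mem_Zp (x : ℚ) : x ∈ Zp p ↔ ‖(x : ℚ_[p])‖ ≤ 1 := Iff.rfl

/-- The inclusion of `ℤ_(p)` in the `p`-adic integers. -/
def embZ : Zp p →+* ℤ_[p] :=
  (Rat.castHom ℚ_[p]).restrict (Zp p) (PadicInt.subring p) (fun _ hx => hx)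

/-- Reduction modulo `p`. -/
def red : Zp p →+* ZMod p := PadicInt.toZMod.comp (embZ p)

lemma mem_Zp_iff (x : ℚ) : x ∈ Zp p ↔ pInt p x := by
  rw [mem_Zp, pInt]
  constructor
  · intro h hd
    have hx : x ≠ 0 := by
      rintro rfl
      simp at hd
      exact hp.out.one_lt.ne' hd
    have h1 : (x : ℚ_[p]) * (x.den : ℚ_[p]) = (x.num : ℚ_[p]) := by
      exact_mod_cast Rat.mul_den_eq_num x
    have h2 : ‖(x.den : ℚ_[p])‖ < 1 := by
      rw [Padic.norm_natCast_lt_one_iff]; exact hd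
    have h3 : ‖(x.num : ℚ_[p])‖ < 1 := by
      rw [← h1, norm_mul]
      calc _ ≤ 1 * ‖(x.den : ℚ_[p])‖ := by gcongr
        _ < 1 := by simpa using h2
    rw [Padic.norm_intCast_lt_one_iff] at h3
    have h4 : p ∣ x.num.natAbs := Int.natCast_dvd.mp h3
    have := Nat.dvd_gcd h4 hd
    rw [x.reduced] at this
    exact hp.out.one_lt.ne' (Nat.dvd_one.mp this)
  · exact fun h => Padic.norm_rat_le_one h

lemma inv_mem (n : ℕ) (h : ¬ p ∣ n) : ((n : ℚ)⁻¹) ∈ Zp p := by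
  rw [mem_Zp]
  have : ‖(n : ℚ_[p])‖ = 1 := by
    rw [Padic.norm_natCast_eq_one_iff]
    exact (Nat.Prime.coprime_iff_not_dvd hp.out).mpr h
  push_cast
  rw [norm_inv, this, inv_one]

lemma red_eq_zero (x : Zp p) (h : red p x = 0) : ∃ y : Zp p, x = p * y := by
  have h1 : embZ p x ∈
      RingHom.ker (PadicInt.toZMod (p := p)) := h
  rw [PadicInt.ker_toZMod, PadicInt.maximalIdeal_eq_span_p, Ideal.mem_span_singleton] at h1
  obtain ⟨z, hz⟩ := h1
  have hp0 : (p : ℚ) ≠ 0 := by exact_mod_cast hp.out.ne_zero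
  have hp0' : (p : ℚ_[p]) ≠ 0 := by exact_mod_cast hp.out.ne_zero
  have hz' : ((x : ℚ) : ℚ_[p]) = p * z := by
    have := congrArg (fun t : ℤ_[p] => (t : ℚ_[p])) hz
    simp only [PadicInt.coe_mul, PadicInt.coe_natCast] at this
    exact this
  refine ⟨⟨(x : ℚ) / p, ?_⟩, ?_⟩
  · rw [mem_Zp]
    push_cast
    rw [hz', mul_div_cancel_left₀ _ hp0']
    exact z.2
  · ext
    push_cast
    field_simp

lemma bern_int (k : ℕ) (hk : k + 1 < p) : bernoulli k ∈ Zp p := by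
  induction k using Nat.strong_induction_on with
  | _ k ih =>
  have h := sum_bernoulli (k + 1)
  rw [Finset.sum_range_succ, Nat.choose_succ_self_right] at h
  have h0 : ((k + 1 : ℕ) : ℚ) ≠ 0 := by positivity
  have hb : bernoulli k = ((if k + 1 = 1 then 1 else 0) -
      ∑ i ∈ range k, ((k + 1).choose i : ℚ) * bernoulli i) * ((k + 1 : ℕ) : ℚ)⁻¹ := by
    rw [← h]; field_simp; ring
  rw [hb]
  refine mul_mem (sub_mem ?_ (sum_mem fun i hi => mul_mem (natCast_mem _ _) ?_)) (inv_mem p _ ?_)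
  · split_ifs
    · exact one_mem _
    · exact zero_mem _
  · have := mem_range.mp hi
    exact ih i this (by omega)
  · exact Nat.not_dvd_of_pos_of_lt (by omega) hk

lemma bern_A (hp5 : 5 ≤ p) : ∃ y ∈ Zp p, p * bernoulli (p - 1) = -1 + p * y := by
  obtain ⟨m, rfl⟩ : ∃ m, p = m + 2 := ⟨p - 2, by omega⟩
  have h := sum_bernoulli (m + 2)
  rw [if_neg (by omega), Finset.sum_range_succ, Nat.choose_succ_self_right,
    Finset.sum_range_succ'] at h
  have hs : ∃ y ∈ Zp (m + 2), ∑ k ∈ range m, ((m + 2).choose (k + 1) : ℚ) * bernoulli (k + 1) =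
      ((m + 2 : ℕ) : ℚ) * y := by
    have : ∀ k, ∃ y : ℚ, k ∈ range m → y ∈ Zp (m + 2) ∧
      ((m + 2).choose (k + 1) : ℚ) * bernoulli (k + 1) = ((m + 2 : ℕ) : ℚ) * y := by
      intro k
      by_cases hk : k ∈ range m
      · have := mem_range.mp hk
        obtain ⟨a, ha⟩ := hp.out.dvd_choose_self (k := k + 1) (by omega) (by omega)
        refine ⟨a * bernoulli (k + 1), fun _ => ⟨mul_mem (natCast_mem _ _)
          (bern_int _ _ (by omega)), ?_⟩⟩
        rw [ha]; push_cast; ring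
      · exact ⟨0, fun h => absurd h hk⟩
    choose y hy using this
    refine ⟨∑ k ∈ range m, y k, sum_mem fun k hk => (hy k hk).1, ?_⟩
    rw [mul_sum]
    exact sum_congr rfl fun k hk => (hy k hk).2
  obtain ⟨y, hy, hs⟩ := hs
  refine ⟨-y, neg_mem hy, ?_⟩
  rw [hs] at h
  simp only [Nat.choose_zero_right, bernoulli_zero] at h
  rw [show m + 2 - 1 = m + 1 by omega]
  push_cast at h ⊢
  linarith

lemma bern_B (hp5 : 5 ≤ p) : ∃ y ∈ Zp p, 12 * bernoulli (p + 1) = 1 + p * y := by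
  obtain ⟨y1, hy1, h1⟩ := bern_A p hp5
  have hodd : Odd p := hp.out.odd_of_ne_two (by omega)
  have hBp : bernoulli p = 0 := bernoulli_eq_zero_of_odd hodd (by omega)
  obtain ⟨m, rfl⟩ : ∃ m, p = m + 4 := ⟨p - 4, by omega⟩
  have h := sum_bernoulli (m + 4 + 2)
  rw [if_neg (by omega), Finset.sum_range_succ, Nat.choose_succ_self_right,
    Finset.sum_range_succ, hBp, Finset.sum_range_succ, Finset.sum_range_succ',
    Finset.sum_range_succ', Finset.sum_range_succ'] at h
  have hs : ∃ y ∈ Zp (m + 4), ∑ k ∈ range m, ((m + 4 + 2).choose (k + 1 + 1 + 1) : ℚ) *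
      bernoulli (k + 1 + 1 + 1) = ((m + 4 : ℕ) : ℚ) * y := by
    have : ∀ k, ∃ y : ℚ, k ∈ range m → y ∈ Zp (m + 4) ∧
      ((m + 4 + 2).choose (k + 1 + 1 + 1) : ℚ) * bernoulli (k + 1 + 1 + 1) = ((m + 4 : ℕ) : ℚ) * y := by
      intro k
      by_cases hk : k ∈ range m
      · have := mem_range.mp hk
        have hd : m + 4 ∣ (m + 4 + 2).choose (k + 1 + 1 + 1) := by
          have e : (m + 4 + 2).choose (k + 1 + 1 + 1) = (m + 4).choose (k + 1) +
              2 * (m + 4).choose (k + 2) + (m + 4).choose (k + 3) := by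
            rw [Nat.choose_succ_succ', Nat.choose_succ_succ', Nat.choose_succ_succ' (m + 4) (k + 2)]
            ring
          rw [e]
          refine dvd_add (dvd_add ?_ (Dvd.dvd.mul_left ?_ _)) ?_ <;>
          exact hp.out.dvd_choose_self (by omega) (by omega)
        obtain ⟨a, ha⟩ := hd
        refine ⟨a * bernoulli (k + 1 + 1 + 1), fun _ => ⟨mul_mem (natCast_mem _ _)
          (bern_int _ _ (by omega)), ?_⟩⟩
        rw [ha]; push_cast; ring
      · exact ⟨0, fun h => absurd h hk⟩
    choose y hy using this
    refine ⟨∑ k ∈ range m, y k, sum_mem fun k hk => (hy k hk).1, ?_⟩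
    rw [mul_sum]
    exact sum_congr rfl fun k hk => (hy k hk).2
  obtain ⟨y2, hy2, hs⟩ := hs
  rw [hs] at h
  have hc2 : (((m + 4 + 2).choose (0 + 1 + 1) : ℕ) : ℚ) = ((m : ℚ) + 6) * (m + 5) / 2 := by
    rw [show 0 + 1 + 1 = 2 by rfl, Nat.cast_choose_two]; push_cast; ring
  have hc3 : (((m + 4 + 2).choose (m + 3) : ℕ) : ℚ) = ((m : ℚ) + 6) * (m + 5) * (m + 4) / 6 := by
    rw [show m + 4 + 2 = (m + 3) + 3 by ring, Nat.choose_symm_add]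
    have := Nat.descFactorial_eq_factorial_mul_choose (m + 3 + 3) 3
    have h' : (((m + 3 + 3).descFactorial 3 : ℕ) : ℚ) = ((Nat.factorial 3 : ℕ) : ℚ) * ((m + 3 + 3).choose 3 : ℕ) := by
      exact_mod_cast this
    simp [Nat.descFactorial, Nat.factorial] at h'
    rw [eq_div_iff (by norm_num)]
    linarith
  have hni : ((m + 4 + 2 : ℕ) : ℚ)⁻¹ ∈ Zp (m + 4) := by
    refine inv_mem _ _ fun hd => ?_
    have := (Nat.dvd_add_right (dvd_refl (m + 4))).mp hd
    have := Nat.le_of_dvd (by norm_num) this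
    omega
  rw [show m + 4 - 1 = m + 3 by omega] at h1
  have h0 : ((m : ℚ) + 6) ≠ 0 := by positivity
  refine ⟨((m + 4 : ℕ) + (8 : ℕ) - (12 : ℕ) * y2 -
    (2 * (m + 4 + 2) * (m + 4 + 1) : ℕ) * y1) * ((m + 4 + 2 : ℕ) : ℚ)⁻¹, mul_mem ?_ hni, ?_⟩
  · exact sub_mem (sub_mem (add_mem (natCast_mem _ _) (natCast_mem _ _))
      (mul_mem (natCast_mem _ _) hy2)) (mul_mem (natCast_mem _ _) hy1)
  · have hb2 : bernoulli (0 + 1 + 1) = 6⁻¹ := bernoulli_two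
    have hb1 : bernoulli (0 + 1) = -1 / 2 := bernoulli_one
    rw [hb2, hb1, hc2, hc3] at h
    simp only [Nat.choose_zero_right, bernoulli_zero, zero_add, Nat.choose_one_right] at h
    push_cast at h h1 ⊢
    have e : ((m : ℚ) + 4 + 2)⁻¹ * (m + 6) = 1 := by
      rw [show (m : ℚ) + 4 + 2 = m + 6 by ring]; exact inv_mul_cancel₀ h0
    apply mul_left_cancel₀ h0
    linear_combination 12 * h - 2 * (m + 6) * (m + 5) * h1 - ((m + 4 + 8 - 12 * y2 -
      (2 * ((m : ℚ) + 4 + 2) * (m + 4 + 1)) * y1) * (m + 4)) * e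

end Local
section Transfer

variable (p : ℕ) [hp : Fact p.Prime]

lemma coe_num (n : ℕ) [n.AtLeastTwo] : (((ofNat(n) : Zp p)) : ℚ) = ofNat(n) := rfl

lemma lift_poly (f : Poly3) (h : polyPInt p f) :
    ∃ g : MvPolynomial (Fin 3) (Zp p), map (Zp p).subtype g = f := by
  have : f ∈ Set.range (map (σ := Fin 3) (Zp p).subtype) := by
    rw [mem_range_map_iff_coeffs_subset]
    intro x hx
    rw [Finset.mem_coe, mem_coeffs_iff] at hx
    obtain ⟨m, _, rfl⟩ := hx
    exact ⟨⟨_, (mem_Zp_iff p _).mpr (h m)⟩, rfl⟩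
  exact this

lemma aeval_pmap {R T : Type} [CommRing R] [CommRing T] (ψ : R →+* T) (x : Fin 3 → PowerSeries R)
    (f : MvPolynomial (Fin 3) R) :
    PowerSeries.map ψ (aeval x f) = aeval (fun i => PowerSeries.map ψ (x i)) (map ψ f) := by
  induction f using MvPolynomial.induction_on with
  | C a => rw [map_C, C_eq, C_eq, PowerSeries.map_C]
  | add f g hf hg => rw [map_add, map_add, hf, hg, map_add, map_add]
  | mul_X f i hf => rw [map_mul, map_mul, hf, map_mul, map_mul, map_X, aeval_X, aeval_X]

/-- The `q`-expansions over `ℤ_(p)`. -/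
def xS : Fin 3 → PowerSeries (Zp p) :=
  fun i => PowerSeries.map (Int.castRingHom (Zp p)) (![eisZ (-24) 1, eisZ 240 3, eisZ (-504) 5] i)

lemma xS_red : (fun i => PowerSeries.map (red p) (xS p i)) = xK p := by
  funext i
  ext n
  simp [xS, xK]

lemma xS_Q : (fun i => PowerSeries.map (Zp p).subtype (xS p i)) = ![E2s, E4s, E6s] := by
  funext i
  ext n
  fin_cases i <;> simp [xS, eisZ, E2s, E4s, E6s, sigmaQ] <;> split_ifs <;> simp [coe_num]

lemma coeff_red (f : MvPolynomial (Fin 3) (Zp p)) (n : ℕ) :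
    PowerSeries.coeff n (aeval (xK p) (map (red p) f)) =
      red p (PowerSeries.coeff n (aeval (xS p) f)) := by
  rw [← xS_red, ← aeval_pmap, PowerSeries.coeff_map]

lemma coeff_Q (f : MvPolynomial (Fin 3) (Zp p)) (n : ℕ) :
    ((PowerSeries.coeff n (aeval (xS p) f) : Zp p) : ℚ) =
      PowerSeries.coeff n (Phi (map (Zp p).subtype f)) := by
  rw [Phi, ← xS_Q p, ← aeval_pmap, PowerSeries.coeff_map]; rfl

lemma red_p : red p (p : Zp p) = 0 := by simp

lemma A_red (hp5 : 5 ≤ p) (f : MvPolynomial (Fin 3) (Zp p))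
    (h : Phi (map (Zp p).subtype f) = EAs p) : aeval (xK p) (map (red p) f) = 1 := by
  obtain ⟨y, hy, hB⟩ := bern_A p hp5
  ext n
  rw [coeff_red, PowerSeries.coeff_one]
  have hq := coeff_Q p f n
  rw [h, EAs, PowerSeries.coeff_mk] at hq
  generalize PowerSeries.coeff n (aeval (xS p) f) = a at hq ⊢
  by_cases hn : n = 0
  · rw [if_pos hn] at hq ⊢
    have : a = 1 := by ext; rw [hq]; rfl
    rw [this, map_one]
  · rw [if_neg hn] at hq ⊢
    have hB0 : bernoulli (p - 1) ≠ 0 := by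
      intro h0
      rw [h0] at hB
      have : (1 : Zp p) = p * ⟨y, hy⟩ := by ext; push_cast; linarith
      have := congrArg (red p) this
      rw [map_mul, red_p, map_one, zero_mul] at this
      exact one_ne_zero this
    have key : a * (-1 + p * ⟨y, hy⟩) =
        p * (-(2 * ((p : Zp p) - 1)) * ∑ d ∈ n.divisors, (d : Zp p) ^ (p - 2)) := by
      ext
      push_cast [coe_num]
      rw [← hB, hq, sigmaQ]
      field_simp
    have := congrArg (red p) key
    rw [map_mul, map_add, map_neg, map_one, map_mul, map_mul, red_p] at this
    linear_combination -this

lemma B_red (hp5 : 5 ≤ p) (f : MvPolynomial (Fin 3) (Zp p))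
    (h : Phi (map (Zp p).subtype f) = EBs p) : aeval (xK p) (map (red p) f) = xK p 0 := by
  obtain ⟨y, hy, hB⟩ := bern_B p hp5
  ext n
  rw [coeff_red]
  have hq := coeff_Q p f n
  rw [h, EBs, PowerSeries.coeff_mk] at hq
  generalize PowerSeries.coeff n (aeval (xS p) f) = a at hq ⊢
  by_cases hn : n = 0
  · rw [if_pos hn] at hq
    have : a = 1 := by ext; rw [hq]; rfl
    rw [this, map_one]
    simp [xK, eisZ, hn]
  · rw [if_neg hn] at hq
    have hB0 : bernoulli (p + 1) ≠ 0 := by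
      intro h0
      rw [h0] at hB
      have : (-1 : Zp p) = p * ⟨y, hy⟩ := by ext; push_cast; linarith
      have := congrArg (red p) this
      rw [map_mul, red_p, map_neg, map_one, zero_mul] at this
      exact one_ne_zero (neg_eq_zero.mp this)
    have key : a * (1 + p * ⟨y, hy⟩) =
        (-(24 * ((p : Zp p) + 1)) * ∑ d ∈ n.divisors, (d : Zp p) ^ p) := by
      ext
      push_cast [coe_num]
      rw [← hB, hq, sigmaQ]
      field_simp
      ring
    have := congrArg (red p) key
    simp only [map_mul, map_add, map_neg, map_one, map_sum, map_pow, map_natCast,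
      ZMod.pow_card, map_ofNat, CharP.cast_eq_zero] at this
    simp [xK, eisZ, hn]
    linear_combination this

lemma Dop_eq (f : Poly3) : Dop f = DG (1/12 : ℚ) f := by
  simp only [Dop, DG, Derivation.add_apply, Derivation.smul_apply, smul_eq_mul]
  norm_num

lemma theta_eq (A B f : Poly3) : thetaOp A B f = TG (1/12 : ℚ) A B f := by
  simp only [thetaOp, TG, Derivation.add_apply, Derivation.smul_apply, smul_eq_mul]
  norm_num

lemma iso_lift (w : ℕ) (f : MvPolynomial (Fin 3) (Zp p)) (h : Isobaric w (map (Zp p).subtype f)) :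
    EG (Zp p) f = w * f := by
  refine EG_of_iso f w fun μ hμ => h μ ?_
  rw [mem_support_iff, coeff_map]
  simpa using hμ

lemma noP_lift (f : MvPolynomial (Fin 3) (Zp p)) (h : NoP (map (Zp p).subtype f)) :
    pderiv 0 f = 0 := by
  refine d0_of_noP f fun μ hμ => h μ ?_
  rw [mem_support_iff, coeff_map]
  simpa using hμ

lemma map_T_iter {S K : Type} [CommRing S] [CommRing K] (φ : S →+* K) (c : S) (A B f) (n : ℕ) :
    map φ ((TG c A B)^[n] f) = (TG (φ c) (map φ A) (map φ B))^[n] (map φ f) := by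
  induction n with
  | zero => rfl
  | succ n ih => rw [Function.iterate_succ_apply', Function.iterate_succ_apply', map_T, ih]

end Transfer

theorem stmt_6 (p : ℕ) (hp : p.Prime) (hp5 : 5 ≤ p)
    (A : Poly3) (hAiso : Isobaric (p - 1) A) (hAnoP : NoP A)
    (hAint : polyPInt p A) (hAPhi : Phi A = EAs p)
    (B : Poly3) (hBiso : Isobaric (p + 1) B) (hBnoP : NoP B)
    (hBint : polyPInt p B) (hBPhi : Phi B = EBs p)
    (k : ℕ) (hk : 0 < k) (F : Poly3) (hFiso : Isobaric k F) (hFnoP : NoP F)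
    (hFint : polyPInt p F)
    (r : ℕ) (hr : 1 ≤ r) :
    ∃ H : Poly3, polyPInt p H ∧
      Dop^[r * p] F - A ^ r * (thetaOp A B)^[r] F = (p : Poly3) * H := by
  have : Fact p.Prime := ⟨hp⟩
  obtain ⟨A, rfl⟩ := lift_poly p A hAint
  obtain ⟨B, rfl⟩ := lift_poly p B hBint
  obtain ⟨F, rfl⟩ := lift_poly p F hFint
  have h12 : ((12 : ℕ) : ℚ)⁻¹ ∈ Zp p := by
    refine inv_mem p 12 fun h => ?_
    rw [show 12 = 2 ^ 2 * 3 by norm_num] at h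
    rcases hp.dvd_mul.mp h with h | h
    · have := Nat.le_of_dvd (by norm_num) (hp.dvd_of_dvd_pow h); omega
    · have := Nat.le_of_dvd (by norm_num) h; omega
  let c : Zp p := ⟨((12 : ℕ) : ℚ)⁻¹, h12⟩
  have hc : 12 * c = 1 := by ext; simp [c, coe_num]
  have hcq : (Zp p).subtype c = 1 / 12 := by simp [c]
  have hmain := main_S p hp5 (red p) c hc A B
    (by rw [iso_lift p _ A hAiso, Nat.cast_sub hp.one_le, Nat.cast_one])
    (by rw [iso_lift p _ B hBiso]; push_cast; rfl)
    (noP_lift p A hAnoP) (noP_lift p B hBnoP) (A_red p hp5 A hAPhi) (B_red p hp5 B hBPhi)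
    k F (iso_lift p _ F hFiso) (noP_lift p F hFnoP) r
  have hD : Dop = DG (1/12 : ℚ) := funext Dop_eq
  have hT : thetaOp (map (Zp p).subtype A) (map (Zp p).subtype B) =
      TG (1/12 : ℚ) (map (Zp p).subtype A) (map (Zp p).subtype B) := funext (theta_eq _ _)
  have hG : Dop^[r * p] (map (Zp p).subtype F) - (map (Zp p).subtype A) ^ r *
      (thetaOp (map (Zp p).subtype A) (map (Zp p).subtype B))^[r] (map (Zp p).subtype F) =
      map (Zp p).subtype ((DG c)^[r * p] F - A ^ r * (TG c A B)^[r] F) := by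
    rw [map_sub, map_mul, map_pow, map_D_iter, map_T_iter, hcq, hD, hT]
  rw [hG]
  rw [← sub_eq_zero, ← map_sub] at hmain
  generalize (DG c)^[r * p] F - A ^ r * (TG c A B)^[r] F = G at hmain
  have hp0 : (p : ℚ) ≠ 0 := by exact_mod_cast hp.ne_zero
  refine ⟨C ((p : ℚ)⁻¹) * map (Zp p).subtype G, fun μ => ?_, ?_⟩
  · rw [← mem_Zp_iff, coeff_C_mul, coeff_map]
    have h0 := congrArg (coeff μ) hmain
    rw [coeff_map, coeff_zero] at h0
    obtain ⟨y, hy⟩ := red_eq_zero p _ h0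
    rw [hy]
    have : (p : ℚ)⁻¹ * (Zp p).subtype (p * y) = y := by
      simp; field_simp
    rw [this]
    exact y.2
  · rw [← mul_assoc, show (p : Poly3) = C (p : ℚ) by simp, ← C_mul, mul_inv_cancel₀ hp0, C_1,
      one_mul]
end
end
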